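/- Let k be a perfect field, let n ≥ 2, and let G be a finite group such that: (1) G has no proper subgroup of index at most n (in particular |G| > n); (2) G contains a subgroup M with |M| > n that acts faithfully on the projective line P^1 over k; and (3) G does not act nontrivially on a smooth curve of genus g ≤ (n−1)^2. Then ed_k(G; ≤ n) > 1. -/

import Mathlib

open IntermediateField Multiplicative

/-- `K` is (the function field of) an irreducible variety over `k`:
a finitely generated field extension of `k`. -/
def IsFunctionField (k K : Type) [Field k] [Field K] [Algebra k K] : Prop :=
  ∃ s : Finset K, IntermediateField.adjoin k (s : Set K) = ⊤

/-- The variety with function field `K` has dimension at most `d`, i.e. the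
transcendence degree of `K/k` is at most `d`. -/
def DimLE (k K : Type) [Field k] [Field K] [Algebra k K] (d : ℕ) : Prop :=
  ∃ s : Finset K, s.card ≤ d ∧ Algebra.IsAlgebraic (IntermediateField.adjoin k (s : Set K)) K

/-- `K` is the function field of an irreducible algebraic curve over `k`: a finitely
generated field extension of `k` of transcendence degree one. -/
def IsCurveField (k K : Type) [Field k] [Field K] [Algebra k K] : Prop :=
  IsFunctionField k K ∧ DimLE k K 1 ∧ ∃ x : K, Transcendental k x

/-- The rational function `f` on the curve with function field `K` has degree `n`,
i.e. the corresponding dominant rational map to `P¹` is generically `n`-to-1: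
`[K : k(f)] = n` (in particular this extension is finite). -/
def RatFnDegree (k K : Type) [Field k] [Field K] [Algebra k K] (f : K) (n : ℕ) : Prop :=
  FiniteDimensional (IntermediateField.adjoin k ({f} : Set K)) K ∧
    Module.finrank (IntermediateField.adjoin k ({f} : Set K)) K = n

section Genus

variable (k F : Type) [Field k] [Field F] [Algebra k F]

/-- A place of the (smooth projective model of the) curve with function field `F`
over `k`: a normalized discrete valuation of `F` that is trivial on `k`. -/
structure PlaceOf where
  v : Valuation F (WithZero (Multiplicative ℤ))
  surjective : Function.Surjective v
  trivialOnBase : ∀ c : k, c ≠ 0 → v (algebraMap k F c) = 1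

variable {k F}

/-- The degree `[κ(P) : k]` of the residue field of a place over `k`. -/
noncomputable def PlaceOf.degree (P : PlaceOf k F) : ℕ :=
  letI : Algebra k (IsLocalRing.ResidueField P.v.valuationSubring) :=
    ((IsLocalRing.residue (R := ↥P.v.valuationSubring)).comp
      ((algebraMap k F).codRestrict P.v.valuationSubring.toSubring (fun c => by
        rcases eq_or_ne c 0 with h | h
        · simp [h, Valuation.mem_valuationSubring_iff]
        · exact le_of_eq (P.trivialOnBase c h)))).toAlgebra
  Module.finrank k (IsLocalRing.ResidueField P.v.valuationSubring)

variable (k F)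

/-- The degree of a divisor (an element of the free abelian group on the places)
on the curve with function field `F`. -/
noncomputable def DivisorOf.deg (D : PlaceOf k F →₀ ℤ) : ℤ :=
  D.sum fun P n => n * (P.degree : ℤ)

/-- The Riemann–Roch space `L(D) = {f ∈ F : div(f) + D ≥ 0}` of a divisor `D`,
as a `k`-subspace of `F`. -/
noncomputable def RRSpace (D : PlaceOf k F →₀ ℤ) : Submodule k F where
  carrier := {f | ∀ P : PlaceOf k F, P.v f ≤ ((ofAdd (D P) : Multiplicative ℤ) :
    WithZero (Multiplicative ℤ))}
  add_mem' := fun hf hg P => le_trans (Valuation.map_add _ _ _) (max_le (hf P) (hg P))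
  zero_mem' := fun P => by simp
  smul_mem' := fun c f hf P => by
    rw [Algebra.smul_def, Valuation.map_mul]
    rcases eq_or_ne c 0 with h | h
    · simp [h]
    · rw [P.trivialOnBase c h, one_mul]
      exact hf P

/-- `ℓ(D) = dim_k L(D)`. -/
noncomputable def ell (D : PlaceOf k F →₀ ℤ) : ℕ :=
  Module.finrank k (RRSpace k F D)

/-- The genus of the (smooth projective model of the) curve with function field
`F` over `k`: the maximal value of `deg D + ℓ(0) - ℓ(D)` over all divisors `D`
(for `D = 0` this value is `0`, and by the Riemann–Roch theorem the maximum is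
attained, and equals the genus, once `deg D` is large enough). -/
noncomputable def genus : ℕ :=
  sSup {g : ℕ | ∃ D : PlaceOf k F →₀ ℤ,
    (g : ℤ) + ell k F D = DivisorOf.deg k F D + ell k F 0}

end Genus

/-- A faithful `G`-variety over `k`, in birational terms: a finitely generated
field extension `K/k` (the function field) equipped with a faithful `G`-action
on `K` by `k`-automorphisms (i.e. a faithful action on the variety by birational
automorphisms). -/
structure GVariety (k : Type) [Field k] (G : Type) [Group G] where
  K : Type
  [field : Field K]
  [algebra : Algebra k K]
  fg : IsFunctionField k K
  action : G →* (K ≃ₐ[k] K)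
  faithful : Function.Injective action

attribute [instance] GVariety.field GVariety.algebra

section ED

variable {k : Type} [Field k] {G : Type} [Group G]

/-- A `G`-compression `X ⇢ Y`: a dominant rational `G`-map, i.e. a `G`-equivariant
`k`-embedding of function fields `k(Y) ↪ k(X)`. -/
def GVariety.Compression (X Y : GVariety k G) : Prop :=
  ∃ φ : Y.K →ₐ[k] X.K, ∀ (g : G) (y : Y.K), X.action g (φ y) = φ (Y.action g y)

/-- `T ⇢ X` is a `G`-equivariant branched cover of degree at most `n`: a
`G`-equivariant `k`-embedding of function fields `k(X) ↪ k(T)` with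
`[k(T) : k(X)] ≤ n`. -/
def GVariety.IsCoverDegLE (T X : GVariety k G) (n : ℕ) : Prop :=
  ∃ ι : X.K →ₐ[k] T.K,
    FiniteDimensional ι.fieldRange T.K ∧ Module.finrank ι.fieldRange T.K ≤ n ∧
    ∀ (g : G) (x : X.K), T.action g (ι x) = ι (X.action g x)

end ED

/-- `ed_k(G; ≤ n) ≤ d`: every faithful `G`-variety `X` over `k` admits a
`G`-equivariant branched cover `X̃ ⇢ X` of degree at most `n` together with a
`G`-compression `X̃ ⇢ Y` to a faithful `G`-variety `Y` of dimension at most `d`.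
Thus `ed_k(G; ≤ n) > d` is the negation `¬ EDLE k G n d`. -/
def EDLE (k : Type) [Field k] (G : Type) [Group G] (n d : ℕ) : Prop :=
  ∀ X : GVariety k G, ∃ T Y : GVariety k G,
    T.IsCoverDegLE X n ∧ T.Compression Y ∧ DimLE k Y.K d

section Places

open WithZero

variable {k F : Type} [Field k] [Field F] [Algebra k F]

namespace PlaceOf

theorem v_algebraMap_le (P : PlaceOf k F) (c : k) : P.v (algebraMap k F c) ≤ 1 := by
  rcases eq_or_ne c 0 with rfl | h
  · simp
  · exact (P.trivialOnBase c h).le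

theorem v_smul_le (P : PlaceOf k F) (c : k) (f : F) : P.v (c • f) ≤ P.v f := by
  rw [Algebra.smul_def, map_mul]
  exact mul_le_of_le_one_left' (P.v_algebraMap_le c)

theorem exists_v_eq_exp (P : PlaceOf k F) (m : ℤ) : ∃ f : F, P.v f = exp m :=
  P.surjective _

theorem v_aeval_le_one (P : PlaceOf k F) {w : F} (hw : P.v w ≤ 1) (p : Polynomial k) :
    P.v (Polynomial.aeval w p) ≤ 1 := by
  induction p using Polynomial.induction_on' with
  | add p q hp hq => rw [map_add]; exact (P.v.map_add _ _).trans (max_le hp hq)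
  | monomial n a =>
    rw [Polynomial.aeval_monomial, map_mul, map_pow]
    exact mul_le_one' (P.v_algebraMap_le a) (pow_le_one' hw n)

@[ext]
theorem ext' {P Q : PlaceOf k F} (h : P.v = Q.v) : P = Q := by
  cases P; cases Q; simp_all

theorem lt_one_iff_le_exp (P : PlaceOf k F) (f : F) : P.v f < 1 ↔ P.v f ≤ exp (-1 : ℤ) := by
  rcases eq_or_ne (P.v f) 0 with h | h
  · simp [h]
  · rw [← exp_log h, ← exp_zero, exp_lt_exp, exp_le_exp]; omega

/-- The absolute value attached to a place. -/
noncomputable def abs (P : PlaceOf k F) : AbsoluteValue F ℝ where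
  toFun f := (WithZeroMulInt.toNNReal (e := 2) (by simp) (P.v f) : NNReal)
  map_mul' x y := by simp
  nonneg' x := by positivity
  eq_zero' x := by simp
  add_le' x y := by
    have hm := (WithZeroMulInt.toNNReal_strictMono (e := 2) (by norm_num)).monotone
    have h := hm (P.v.map_add x y)
    rw [hm.map_max] at h
    exact_mod_cast h.trans (max_le_add_of_nonneg (zero_le) (zero_le))

theorem abs_le_abs_iff (P : PlaceOf k F) (x y : F) : P.abs x ≤ P.abs y ↔ P.v x ≤ P.v y := by
  have hm := (WithZeroMulInt.toNNReal_strictMono (e := 2) (by norm_num))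
  change ((_ : NNReal) : ℝ) ≤ ((_ : NNReal) : ℝ) ↔ _
  rw [NNReal.coe_le_coe, hm.le_iff_le]

theorem eq_of_isEquiv {P Q : PlaceOf k F} (h : P.abs.IsEquiv Q.abs) : P = Q := by
  have h' : ∀ x y, P.v x ≤ P.v y ↔ Q.v x ≤ Q.v y := fun x y => by
    rw [← abs_le_abs_iff, ← abs_le_abs_iff]; exact h x y
  have hlt : ∀ x, P.v x < 1 ↔ Q.v x < 1 := fun x => by
    simpa using not_congr (h' 1 x)
  have heq : ∀ x y, P.v x = P.v y ↔ Q.v x = Q.v y := fun x y => by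
    simp [le_antisymm_iff, h']
  obtain ⟨p, hp⟩ := P.exists_v_eq_exp (-1)
  obtain ⟨q, hq⟩ := Q.exists_v_eq_exp (-1)
  have hpq : Q.v p = exp (-1 : ℤ) := by
    apply le_antisymm
    · rw [← lt_one_iff_le_exp, ← hlt, lt_one_iff_le_exp, hp]
    · rw [← hq, ← h', hp, ← lt_one_iff_le_exp, hlt, lt_one_iff_le_exp, hq]
  ext f
  rcases eq_or_ne f 0 with rfl | hf
  · simp
  · have hP : P.v f ≠ 0 := by simpa using hf
    have e : P.v f = P.v (p ^ (-(log (P.v f)))) := by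
      rw [map_zpow₀, hp, ← exp_zsmul]; simp [exp_log hP]
    rw [(heq _ _).1 e, map_zpow₀, hpq, ← exp_zsmul]; simp [exp_log hP]

/-- Weak approximation for finitely many places. -/
theorem exists_approx (S : Finset (PlaceOf k F)) (a : PlaceOf k F → F) (m : ℤ) :
    ∃ f : F, ∀ P ∈ S, P.v (f - a P) ≤ exp m := by
  have hd := AbsoluteValue.denseRange_algebraMap_pi (v := fun P : S => P.1.abs)
    (fun P => by
      obtain ⟨p, hp⟩ := P.1.exists_v_eq_exp (-1)
      refine ⟨p, by rintro rfl; exact exp_ne_zero (hp.symm.trans P.1.v.map_zero), fun h1 => ?_⟩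
      have := (P.1.abs_le_abs_iff 1 p).1 (by simp [h1])
      rw [hp, map_one, ← exp_zero, exp_le_exp] at this
      omega)
    (fun P Q hPQ h => hPQ (Subtype.ext (eq_of_isEquiv h)))
  obtain ⟨f, hf⟩ := Metric.denseRange_iff.1 hd
    (fun P => (WithAbs.equiv P.1.abs).symm (a P.1)) ((2 : ℝ) ^ m) (by positivity)
  refine ⟨f, fun P hP => ?_⟩
  rw [dist_pi_lt_iff (by positivity)] at hf
  have h1 := hf ⟨P, hP⟩
  rw [dist_comm, dist_eq_norm] at h1
  have h2 : P.abs (f - a P) < (2 : ℝ) ^ m := h1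
  obtain ⟨p, hp⟩ := P.exists_v_eq_exp m
  have h3 : P.abs p = (2 : ℝ) ^ m := by
    change ((WithZeroMulInt.toNNReal (e := 2) (by simp) (P.v p) : NNReal) : ℝ) = _
    rw [hp, WithZeroMulInt.toNNReal_neg_apply _ (by simp)]
    simp [exp]
  rw [← h3] at h2
  have := (P.abs_le_abs_iff _ _).1 h2.le
  rwa [hp] at this

/-- The residue field of a place. -/
abbrev Res (P : PlaceOf k F) := IsLocalRing.ResidueField P.v.valuationSubring

/-- The `k`-algebra structure on the residue field used in `PlaceOf.degree`. -/
noncomputable instance resAlgebra (P : PlaceOf k F) : Algebra k P.Res :=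
  ((IsLocalRing.residue (R := ↥P.v.valuationSubring)).comp
      ((algebraMap k F).codRestrict P.v.valuationSubring.toSubring (fun c =>
        P.v_algebraMap_le c))).toAlgebra

theorem degree_eq (P : PlaceOf k F) : P.degree = Module.finrank k P.Res := rfl

/-- The elements of value at most `exp m` at `P`. -/
def ball (P : PlaceOf k F) (m : ℤ) : Submodule k F where
  carrier := {f | P.v f ≤ exp m}
  add_mem' := fun hf hg => (P.v.map_add _ _).trans (max_le hf hg)
  zero_mem' := by simp
  smul_mem' := fun c f hf => (P.v_smul_le c f).trans hf

theorem mem_ball {P : PlaceOf k F} {m : ℤ} {f : F} : f ∈ P.ball m ↔ P.v f ≤ exp m := Iff.rfl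

/-- The residue map on the ball of radius one. -/
noncomputable def resMap (P : PlaceOf k F) : P.ball 0 →ₗ[k] P.Res where
  toFun f := IsLocalRing.residue P.v.valuationSubring ⟨f.1, f.2⟩
  map_add' f g := by
    rw [← map_add]; rfl
  map_smul' c f := by
    rw [RingHom.id_apply, Algebra.smul_def]
    change _ = IsLocalRing.residue _ _ * _
    rw [← map_mul]
    congr 1
    exact Subtype.ext (Algebra.smul_def c f.1)

theorem resMap_surjective (P : PlaceOf k F) : Function.Surjective P.resMap := fun x => by
  obtain ⟨y, rfl⟩ := IsLocalRing.residue_surjective x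
  exact ⟨⟨y.1, y.2⟩, rfl⟩

theorem resMap_eq_zero_iff (P : PlaceOf k F) (f : P.ball 0) : P.resMap f = 0 ↔ P.v f.1 < 1 := by
  change IsLocalRing.residue P.v.valuationSubring ⟨f.1, f.2⟩ = 0 ↔ _
  rw [IsLocalRing.residue_eq_zero_iff]
  exact (ValuationSubring.valuation_lt_one_iff P.v.valuationSubring _).trans
    (P.v.isEquiv_valuation_valuationSubring.lt_one_iff_lt_one.symm)

end PlaceOf

end Places

section Places

open WithZero

variable {k F : Type} [Field k] [Field F] [Algebra k F]

namespace PlaceOf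

theorem v_sum_le (P : PlaceOf k F) {ι : Type*} (s : Finset ι) (f : ι → F) {m : ℤ}
    (h : ∀ i ∈ s, P.v (f i) ≤ exp m) : P.v (∑ i ∈ s, f i) ≤ exp m :=
  (P.ball m).sum_mem h

open scoped algebraAdjoinAdjoin in
theorem linearIndependent_adjoin {ι : Type*} [Fintype ι] (u : ι → F) {w : F} (hw0 : w ≠ 0)
    (S : Set (PlaceOf k F)) (hw : ∀ P ∈ S, P.v w ≤ 1) (hu : ∀ i, ∀ P ∈ S, P.v (u i) ≤ 1)
    (h : ∀ c : ι → k, (∀ P ∈ S, P.v (∑ i, c i • u i) ≤ P.v w) → c = 0) :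
    LinearIndependent k⟮w⟯ u := by
  have key : ∀ (N : ℕ) (p : ι → Polynomial k), (∀ i, (p i).natDegree < N) →
      ∑ i, Polynomial.aeval w (p i) * u i = 0 → p = 0 := by
    intro N
    induction N with
    | zero =>
      intro p hp _
      funext i
      exact absurd (hp i) (by simp)
    | succ N ih =>
      intro p hp hs
      have hsplit : ∑ i, (p i).coeff 0 • u i +
          w * ∑ i, Polynomial.aeval w (p i).divX * u i = 0 := by
        rw [← hs, Finset.mul_sum, ← Finset.sum_add_distrib]
        refine Finset.sum_congr rfl fun i _ => ?_
        conv_rhs => rw [← Polynomial.divX_mul_X_add (p i)]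
        simp only [map_add, map_mul, Polynomial.aeval_X, Polynomial.aeval_C, Algebra.smul_def]
        ring
      have hc := h (fun i => (p i).coeff 0) (fun P hP => by
        rw [eq_neg_of_add_eq_zero_left hsplit, Valuation.map_neg, map_mul]
        refine mul_le_of_le_one_right' ?_
        refine P.v_sum_le (m := 0) _ _ fun i _ => ?_
        rw [map_mul]
        exact mul_le_one' (P.v_aeval_le_one (hw P hP) _) (hu i P hP))
      have hc' : ∀ i, (p i).coeff 0 = 0 := fun i => congrFun hc i
      have hX : ∀ i, p i = (p i).divX * Polynomial.X := fun i => by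
        conv_lhs => rw [← Polynomial.divX_mul_X_add (p i), hc' i]
        simp
      rcases Nat.eq_zero_or_pos N with rfl | hN
      · funext i
        rw [Polynomial.eq_C_of_natDegree_eq_zero (p := p i) (by have := hp i; omega), hc' i]
        simp
      have h0 := ih (fun i => (p i).divX)
        (fun i => by rw [Polynomial.natDegree_divX_eq_natDegree_tsub_one]; have := hp i; omega)
        (by
          simp only [hc', zero_smul, Finset.sum_const_zero, zero_add] at hsplit
          exact (mul_eq_zero.1 hsplit).resolve_left hw0)
      funext i
      rw [hX i, congrFun h0 i]
      simp
  rw [← LinearIndependent.iff_fractionRing (Algebra.adjoin k {w}) k⟮w⟯]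
  rw [Fintype.linearIndependent_iff]
  intro g hg
  have hex : ∀ i, ∃ p : Polynomial k, Polynomial.aeval w p = (g i : F) := fun i => by
    exact (AlgHom.mem_range _).1 ((Algebra.adjoin_singleton_eq_range_aeval k w).le (g i).2)
  choose p hp using hex
  have hz := key (Finset.univ.sup (fun i => (p i).natDegree) + 1) p
    (fun i => Nat.lt_succ_of_le (Finset.le_sup (f := fun i => (p i).natDegree) (Finset.mem_univ i)))
    (by
      rw [← hg]
      refine Finset.sum_congr rfl fun i _ => ?_
      rw [hp i]; rfl)
  intro i
  apply Subtype.ext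
  rw [← hp i, hz]
  simp

theorem coeff_eq_zero_of_v_sum_le (P : PlaceOf k F) {κ : Type*} [Fintype κ] (l : κ → P.ball 0)
    (hl : LinearIndependent k fun b => P.resMap (l b)) {π : F} (hπ : P.v π = exp (-1)) :
    ∀ (m : ℕ) (c : Fin m → κ → k),
      P.v (∑ i, ∑ b, c i b • ((l b : F) * π ^ (i : ℕ))) ≤ exp (-(m : ℤ)) → c = 0 := by
  intro m
  induction m with
  | zero => intro c _; exact Subsingleton.elim _ _
  | succ m ih =>
    intro c hc
    have hsplit : ∑ i, ∑ b, c i b • ((l b : F) * π ^ (i : ℕ)) =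
        ((∑ b, c 0 b • l b : P.ball 0) : F) +
          π * ∑ i : Fin m, ∑ b, c i.succ b • ((l b : F) * π ^ (i : ℕ)) := by
      rw [Fin.sum_univ_succ, Finset.mul_sum]
      congr 1
      · simp
      · refine Finset.sum_congr rfl fun i _ => ?_
        rw [Finset.mul_sum]
        refine Finset.sum_congr rfl fun b _ => ?_
        rw [mul_smul_comm, Fin.val_succ, pow_succ]
        congr 1
        ring
    have hrest : P.v (∑ i : Fin m, ∑ b, c i.succ b • ((l b : F) * π ^ (i : ℕ))) ≤ exp (0 : ℤ) := by
      refine P.v_sum_le _ _ fun i _ => P.v_sum_le _ _ fun b _ => ?_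
      refine (P.v_smul_le _ _).trans ?_
      rw [map_mul, map_pow, hπ]
      exact mul_le_one' (l b).2 (pow_le_one' (by rw [← exp_zero, exp_le_exp]; omega) _)
    have h0 : P.v ((∑ b, c 0 b • l b : P.ball 0) : F) < 1 := by
      rw [hsplit] at hc
      rw [lt_one_iff_le_exp]
      rw [← add_sub_cancel_right ((∑ b, c 0 b • l b : P.ball 0) : F)
        (π * ∑ i : Fin m, ∑ b, c i.succ b • ((l b : F) * π ^ (i : ℕ)))]
      refine (P.v.map_sub _ _).trans (max_le (hc.trans ?_) ?_)
      · rw [exp_le_exp]; push_cast; omega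
      · rw [map_mul, hπ]
        exact mul_le_of_le_one_right' hrest
    rw [← resMap_eq_zero_iff, map_sum] at h0
    simp only [map_smul] at h0
    have hc0 := Fintype.linearIndependent_iff.1 hl _ h0
    have hs := ih (fun i b => c i.succ b) (by
      rw [hsplit] at hc
      simp only [hc0, zero_smul, Finset.sum_const_zero, ZeroMemClass.coe_zero, zero_add,
        map_mul, hπ] at hc
      have e : exp (-((m + 1 : ℕ) : ℤ)) = exp (-1 : ℤ) * exp (-(m : ℤ)) := by
        rw [← exp_add]; congr 1; push_cast; ring
      rw [e] at hc
      exact le_of_mul_le_mul_left hc (zero_lt_iff.2 exp_ne_zero))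
    funext i b
    refine Fin.cases ?_ (fun j => ?_) i
    · exact hc0 b
    · exact congrFun (congrFun hs j) b

theorem sum_log_mul_card_le {z : F} [FiniteDimensional k⟮z⟯ F] (S : Finset (PlaceOf k F))
    (hS : ∀ P ∈ S, 1 < P.v z) (d : PlaceOf k F → ℕ)
    (hd : ∀ P ∈ S, ∃ l : Fin (d P) → P.ball 0, LinearIndependent k fun b => P.resMap (l b)) :
    ∑ P ∈ S, (log (P.v z)).toNat * d P ≤ Module.finrank k⟮z⟯ F := by
  classical
  choose! l hl using hd
  have hz : z ≠ 0 ∨ S = ∅ := by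
    rcases S.eq_empty_or_nonempty with h | ⟨P, hP⟩
    · exact Or.inr h
    · left; rintro rfl; have := hS P hP; simp at this
  rcases hz with hz | rfl
  swap; · simp
  have hlog : ∀ P ∈ S, 0 < log (P.v z) := fun P hP => by
    have := hS P hP
    rwa [← exp_log (x := P.v z) (by simpa using hz), ← exp_zero, exp_lt_exp] at this
  choose π hπ using fun P : PlaceOf k F => P.exists_v_eq_exp (-1)
  let M : ℤ := ∑ P ∈ S, log (P.v z)
  have hM : ∀ P ∈ S, log (P.v z) ≤ M := fun P hP =>
    Finset.single_le_sum (f := fun P => log (P.v z)) (fun Q hQ => (hlog Q hQ).le) hP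
  let ι := Σ P : S, Fin (log (P.1.v z)).toNat × Fin (d P.1)
  let a : ι → PlaceOf k F → F := fun i Q =>
    if Q = i.1.1 then (l i.1.1 i.2.2 : F) * (π i.1.1) ^ (i.2.1 : ℕ) else 0
  choose u hu using fun i : ι => exists_approx S (a i) (-M)
  have hvw : ∀ P ∈ S, P.v z⁻¹ = exp (-log (P.v z)) := fun P hP => by
    rw [map_inv₀, exp_neg, exp_log (by simpa using hz)]
  have hsmall : ∀ i, ∀ P ∈ S, P.v (u i - a i P) ≤ exp (-log (P.v z)) := fun i P hP =>
    (hu i P hP).trans (by rw [exp_le_exp]; have := hM P hP; omega)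
  have ha : ∀ (i : ι) (P : PlaceOf k F), P.v (a i P) ≤ exp (0 : ℤ) := fun i P => by
    by_cases h : P = i.1.1
    · subst h
      simp only [a, if_true, map_mul, map_pow, hπ]
      exact mul_le_one' (l i.1.1 i.2.2).2
        (pow_le_one' (by rw [← exp_zero, exp_le_exp]; omega) _)
    · simp [a, h]
  have hli : LinearIndependent k⟮z⁻¹⟯ u := by
    refine linearIndependent_adjoin u (inv_ne_zero hz) (S : Set _) ?_ ?_ ?_
    · intro P hP
      rw [hvw P hP, ← exp_zero, exp_le_exp]; have := hlog P hP; omega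
    · intro i P hP
      rw [← sub_add_cancel (u i) (a i P)]
      refine (P.v.map_add _ _).trans (max_le ((hsmall i P hP).trans ?_) (ha i P))
      rw [← exp_zero, exp_le_exp]; have := hlog P hP; omega
    · intro c hc
      have hloc : ∀ P : S, (fun (i : Fin (log (P.1.v z)).toNat) (b : Fin (d P.1)) =>
          c ⟨P, (i, b)⟩) = 0 := by
        intro P
        apply coeff_eq_zero_of_v_sum_le P.1 (l P.1) (hl P.1 P.2) (hπ P.1)
        rw [Int.toNat_of_nonneg (hlog P.1 P.2).le]
        have e : ∑ i : Fin (log (P.1.v z)).toNat, ∑ b : Fin (d P.1),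
            c ⟨P, (i, b)⟩ • ((l P.1 b : F) * (π P.1) ^ (i : ℕ)) = ∑ i, c i • a i P.1 := by
          rw [Fintype.sum_sigma, Finset.sum_eq_single P]
          · rw [Fintype.sum_prod_type]
            simp [a]
          · intro Q _ hQ
            refine Finset.sum_eq_zero fun x _ => ?_
            simp [a, Ne.symm hQ]
          · simp
        rw [e, ← sub_sub_cancel (∑ i, c i • u i) (∑ i, c i • a i P.1), ← Finset.sum_sub_distrib]
        refine (P.1.v.map_sub _ _).trans (max_le ?_ ?_)
        · rw [← hvw P.1 P.2]; exact hc P.1 P.2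
        · refine P.1.v_sum_le _ _ fun i _ => ?_
          rw [← smul_sub]
          exact (P.1.v_smul_le _ _).trans (hsmall i P.1 P.2)
      funext ⟨P, i, b⟩
      exact congrFun (congrFun (hloc P) i) b
  have hinv : k⟮z⁻¹⟯ = k⟮z⟯ := by
    apply le_antisymm
    · rw [adjoin_simple_le_iff]; exact inv_mem (mem_adjoin_simple_self k z)
    · rw [adjoin_simple_le_iff]
      simpa using inv_mem (mem_adjoin_simple_self k z⁻¹)
  rw [hinv] at hli
  refine le_trans (le_of_eq ?_) hli.fintype_card_le_finrank
  rw [Fintype.card_sigma]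
  simp only [Fintype.card_prod, Fintype.card_fin]
  rw [Finset.sum_coe_sort S (fun P => (log (P.v z)).toNat * d P)]

end PlaceOf

end Places

section Places

open WithZero

variable {k F : Type} [Field k] [Field F] [Algebra k F]

variable (k F) in
/-- A field extension `F/k` of transcendence degree at most one which is finite over each
rational subfield and whose field of constants is finite over `k`. -/
class IsCurveLike : Prop where
  finite_adjoin : ∀ z : F, Transcendental k z → FiniteDimensional k⟮z⟯ F
  finite_constants : FiniteDimensional k (RRSpace k F 0)

theorem mem_RRSpace {D : PlaceOf k F →₀ ℤ} {f : F} :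
    f ∈ RRSpace k F D ↔ ∀ P : PlaceOf k F, P.v f ≤ exp (D P) := Iff.rfl

theorem RRSpace_mono {D D' : PlaceOf k F →₀ ℤ} (h : D ≤ D') : RRSpace k F D ≤ RRSpace k F D' :=
  fun _ hf P => (hf P).trans (exp_le_exp.2 (h P))

theorem mul_mem_RRSpace {D D' : PlaceOf k F →₀ ℤ} {f g : F} (hf : f ∈ RRSpace k F D)
    (hg : g ∈ RRSpace k F D') : f * g ∈ RRSpace k F (D + D') := fun P => by
  rw [map_mul]
  exact (mul_le_mul' (hf P) (hg P)).trans (le_of_eq (exp_add _ _).symm)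

theorem one_mem_RRSpace {D : PlaceOf k F →₀ ℤ} (hD : 0 ≤ D) : (1 : F) ∈ RRSpace k F D :=
  fun P => by
    rw [map_one]
    exact le_trans (le_of_eq exp_zero.symm) (exp_le_exp.2 (hD P))

theorem pow_mem_RRSpace {D : PlaceOf k F →₀ ℤ} {f : F} (hf : f ∈ RRSpace k F D) (m : ℕ) :
    f ^ m ∈ RRSpace k F (m • D) := by
  induction m with
  | zero => simpa using one_mem_RRSpace (F := F) (k := k) le_rfl
  | succ m ih => rw [pow_succ, succ_nsmul]; exact mul_mem_RRSpace ih hf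

namespace PlaceOf

theorem v_le_one_of_isAlgebraic (P : PlaceOf k F) {f : F} (hf : IsAlgebraic k f) :
    P.v f ≤ 1 := by
  obtain ⟨p, hp, h0⟩ := isAlgebraic_iff_isIntegral.1 hf
  exact (Valuation.integer.integers P.v).mem_of_integral
    ⟨p.map ((algebraMap k F).codRestrict P.v.integer fun c => P.v_algebraMap_le c), hp.map _, by
      rw [Polynomial.eval₂_map]; exact h0⟩

theorem v_eq_one_of_isAlgebraic (P : PlaceOf k F) {f : F} (hf : IsAlgebraic k f) (h : f ≠ 0) :
    P.v f = 1 := by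
  refine le_antisymm (P.v_le_one_of_isAlgebraic hf) ?_
  have h1 := P.v_le_one_of_isAlgebraic hf.inv
  rw [map_inv₀] at h1
  exact (inv_le_one₀ (zero_lt_iff.2 (by simpa using h))).1 h1

theorem one_lt_v_iff (P : PlaceOf k F) {f : F} : 1 < P.v f ↔ 0 < log (P.v f) := by
  rcases eq_or_ne f 0 with rfl | h
  · simp
  · rw [← exp_lt_exp (a := 0), exp_log (by simpa using h), exp_zero]

variable [IsCurveLike k F]

instance finite_res (P : PlaceOf k F) : FiniteDimensional k P.Res := by
  obtain ⟨z, hz⟩ := P.exists_v_eq_exp 1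
  have h1 : 1 < P.v z := by rw [hz, ← exp_zero, exp_lt_exp]; norm_num
  have hz : Transcendental k z := fun h => (P.v_le_one_of_isAlgebraic h).not_gt h1
  have := IsCurveLike.finite_adjoin z hz
  rw [FiniteDimensional, ← Module.rank_lt_aleph0_iff]
  refine lt_of_le_of_lt (rank_le (n := Module.finrank k⟮z⟯ F) fun s hs => ?_)
    (Cardinal.natCast_lt_aleph0)
  have h2 := sum_log_mul_card_le (z := z) {P} (by simpa using h1) (fun _ => s.card) (by
    simp only [Finset.mem_singleton, forall_eq]
    choose l hl using P.resMap_surjective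
    refine ⟨fun b => l (s.equivFin.symm b), ?_⟩
    simp only [hl]
    exact hs.comp _ s.equivFin.symm.injective)
  rw [Finset.sum_singleton] at h2
  refine le_trans ?_ h2
  have := P.one_lt_v_iff.1 h1
  exact Nat.le_mul_of_pos_left _ (by omega)

theorem degree_pos (P : PlaceOf k F) : 0 < P.degree := by
  rw [degree_eq]; exact Module.finrank_pos

theorem sum_log_mul_degree_le {z : F} (hz : Transcendental k z) (S : Finset (PlaceOf k F))
    (hS : ∀ P ∈ S, 1 < P.v z) :
    ∑ P ∈ S, (log (P.v z)).toNat * P.degree ≤ Module.finrank k⟮z⟯ F := by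
  have := IsCurveLike.finite_adjoin z hz
  refine sum_log_mul_card_le S hS _ fun P _ => ?_
  choose l hl using P.resMap_surjective
  rw [degree_eq]
  refine ⟨fun b => l (Module.finBasis k P.Res b), ?_⟩
  simp only [hl]
  exact (Module.finBasis k P.Res).linearIndependent

theorem finite_poles (z : F) : {P : PlaceOf k F | 1 < P.v z}.Finite := by
  by_cases hz : Transcendental k z
  · by_contra hinf
    obtain ⟨S, hS, hcard⟩ :=
      Set.Infinite.exists_subset_card_eq hinf (Module.finrank k⟮z⟯ F + 1)
    have hle := sum_log_mul_degree_le hz S fun P hP => hS hP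
    have h1 := (Finset.card_nsmul_le_sum S (fun P => (log (P.v z)).toNat * P.degree) 1
      fun P hP => by
        have h1 := P.one_lt_v_iff.1 (hS hP)
        exact Nat.mul_pos (by omega) P.degree_pos).trans hle
    rw [smul_eq_mul, hcard] at h1
    omega
  · convert Set.finite_empty
    ext P
    simpa using P.v_le_one_of_isAlgebraic (not_not.1 hz)

/-- The divisor of poles of a function. -/
noncomputable def poles (z : F) : PlaceOf k F →₀ ℤ :=
  Finsupp.onFinset (finite_poles z).toFinset (fun P => max 0 (log (P.v z))) fun P hP => by
    simp only [Set.Finite.mem_toFinset, Set.mem_ofPred_eq, one_lt_v_iff]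
    by_contra h
    exact hP (max_eq_left (not_lt.1 h))

theorem poles_apply (z : F) (P : PlaceOf k F) : poles z P = max 0 (log (P.v z)) := rfl

theorem poles_nonneg (z : F) : 0 ≤ (poles z : PlaceOf k F →₀ ℤ) := fun P => by
  rw [poles_apply]; exact le_max_left _ _

theorem mem_RRSpace_poles (z : F) : z ∈ RRSpace k F (poles z) := fun P => by
  rcases eq_or_ne z 0 with rfl | h
  · simp
  · change P.v z ≤ exp _
    rw [poles_apply, ← exp_log (x := P.v z) (by simpa using h), exp_le_exp,
      exp_log (by simpa using h)]
    exact le_max_right _ _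

/-- The divisor of a function. -/
noncomputable def prin (z : F) : PlaceOf k F →₀ ℤ := poles z⁻¹ - poles z

theorem prin_apply (z : F) (P : PlaceOf k F) : prin z P = -log (P.v z) := by
  simp only [prin, Finsupp.coe_sub, Pi.sub_apply, poles_apply, map_inv₀, log_inv]
  omega

end PlaceOf

open PlaceOf DivisorOf

theorem adjoin_inv (z : F) : k⟮z⁻¹⟯ = k⟮z⟯ := by
  apply le_antisymm
  · rw [adjoin_simple_le_iff]; exact inv_mem (mem_adjoin_simple_self k z)
  · rw [adjoin_simple_le_iff]
    simpa using inv_mem (mem_adjoin_simple_self k z⁻¹)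

theorem span_RRSpace_mono {D : PlaceOf k F →₀ ℤ} (hD : 0 ≤ D) {x : F} (j : ℕ) :
    Submodule.span k⟮x⟯ (RRSpace k F (j • D) : Set F) ≤
      Submodule.span k⟮x⟯ (RRSpace k F ((j + 1) • D) : Set F) :=
  Submodule.span_mono (RRSpace_mono (nsmul_le_nsmul_left hD (Nat.le_succ j)))

section Deg

open WithZero

theorem deg_add (D E : PlaceOf k F →₀ ℤ) : deg k F (D + E) = deg k F D + deg k F E :=
  Finsupp.sum_add_index' (by simp) (by intros; ring)

@[simp]
theorem deg_zero : deg k F 0 = 0 := Finsupp.sum_zero_index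

theorem deg_neg (D : PlaceOf k F →₀ ℤ) : deg k F (-D) = -deg k F D := by
  have := deg_add D (-D)
  simp at this
  linarith

theorem deg_sub (D E : PlaceOf k F →₀ ℤ) : deg k F (D - E) = deg k F D - deg k F E := by
  rw [sub_eq_add_neg, deg_add, deg_neg]; ring

theorem deg_nsmul (m : ℕ) (D : PlaceOf k F →₀ ℤ) : deg k F (m • D) = m * deg k F D := by
  induction m with
  | zero => simp
  | succ m ih => rw [succ_nsmul, deg_add, ih]; push_cast; ring

@[simp]
theorem deg_single (P : PlaceOf k F) (m : ℤ) :
    deg k F (Finsupp.single P m) = m * P.degree :=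
  Finsupp.sum_single_index (by simp)

theorem deg_nonneg {D : PlaceOf k F →₀ ℤ} (hD : 0 ≤ D) : 0 ≤ deg k F D :=
  Finset.sum_nonneg fun P _ => mul_nonneg (hD P) (by positivity)

end Deg

end Places

section Places

open WithZero

variable {k F : Type} [Field k] [Field F] [Algebra k F] [IsCurveLike k F]

open PlaceOf DivisorOf

theorem finite_RRSpace_add_single (D : PlaceOf k F →₀ ℤ) (P : PlaceOf k F)
    [FiniteDimensional k (RRSpace k F D)] :
    FiniteDimensional k (RRSpace k F (D + Finsupp.single P 1)) ∧
      ell k F (D + Finsupp.single P 1) ≤ ell k F D + P.degree := by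
  classical
  obtain ⟨t, ht⟩ := P.exists_v_eq_exp (-(D P + 1))
  have hle : RRSpace k F D ≤ RRSpace k F (D + Finsupp.single P 1) :=
    RRSpace_mono (le_add_of_nonneg_right (by simp))
  let ψ : RRSpace k F (D + Finsupp.single P 1) →ₗ[k] P.ball 0 :=
    ((LinearMap.mulLeft k t).domRestrict _).codRestrict (P.ball 0) fun f => by
      rw [LinearMap.domRestrict_apply, LinearMap.mulLeft_apply, mem_ball, map_mul, ht]
      refine (mul_le_mul_right (f.2 P) _).trans ?_
      change exp _ * exp _ ≤ _
      rw [← exp_add, exp_le_exp]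
      simp
  let φ := P.resMap ∘ₗ ψ
  have hker : φ.ker = (RRSpace k F D).submoduleOf (RRSpace k F (D + Finsupp.single P 1)) := by
    ext f
    rw [LinearMap.mem_ker, LinearMap.comp_apply, resMap_eq_zero_iff, lt_one_iff_le_exp]
    change P.v (t * f) ≤ _ ↔ f.1 ∈ RRSpace k F D
    have e : exp (-1 : ℤ) = exp (-(D P + 1)) * exp (D P) := by rw [← exp_add]; congr 1; ring
    rw [map_mul, ht, e, mul_le_mul_iff_right₀ (zero_lt_iff.2 exp_ne_zero)]
    refine ⟨fun h Q => ?_, fun h => h P⟩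
    by_cases hQ : Q = P
    · subst hQ; exact h
    · have := f.2 Q
      simpa [Finsupp.single_apply, Ne.symm hQ] using this
  have e1 : φ.ker ≃ₗ[k] RRSpace k F D :=
    (LinearEquiv.ofEq _ _ hker).trans (Submodule.submoduleOfEquivOfLe hle)
  have : Module.Finite k φ.ker := Module.Finite.equiv e1.symm
  have : Module.Finite k (_ ⧸ φ.ker) := Module.Finite.equiv φ.quotKerEquivRange.symm
  have hfin := Module.Finite.of_submodule_quotient φ.ker
  refine ⟨hfin, ?_⟩
  have h1 := φ.finrank_range_add_finrank_ker
  have h2 := φ.range.finrank_le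
  rw [e1.finrank_eq] at h1
  rw [degree_eq]
  unfold ell
  omega

theorem finite_RRSpace_add (D : PlaceOf k F →₀ ℤ) [h : FiniteDimensional k (RRSpace k F D)]
    {E : PlaceOf k F →₀ ℤ} (hE : 0 ≤ E) :
    FiniteDimensional k (RRSpace k F (D + E)) ∧
      (ell k F (D + E) : ℤ) ≤ ell k F D + deg k F E := by
  suffices H : ∀ (E : PlaceOf k F →₀ ℕ) (D : PlaceOf k F →₀ ℤ),
      FiniteDimensional k (RRSpace k F D) →
      FiniteDimensional k (RRSpace k F (D + E.mapRange (↑) rfl)) ∧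
      (ell k F (D + E.mapRange (↑) rfl) : ℤ) ≤ ell k F D + deg k F (E.mapRange (↑) rfl) by
    have e : (E.mapRange Int.toNat rfl).mapRange ((↑) : ℕ → ℤ) rfl = E := by
      ext P; simpa using hE P
    have := H (E.mapRange Int.toNat rfl) D h
    rwa [e] at this
  intro E
  induction E using Finsupp.induction_linear with
  | zero => intro D hD; rw [Finsupp.mapRange_zero, add_zero]; simpa using hD
  | add f g hf hg =>
    intro D hD
    obtain ⟨h1, h2⟩ := hf D hD
    obtain ⟨h3, h4⟩ := hg _ h1
    rw [Finsupp.mapRange_add (by simp), deg_add, ← add_assoc]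
    exact ⟨h3, by linarith⟩
  | single P m =>
    induction m with
    | zero =>
      intro D hD
      rw [Finsupp.single_zero, Finsupp.mapRange_zero, add_zero]
      simpa using hD
    | succ m ih =>
      intro D hD
      obtain ⟨h1, h2⟩ := ih D hD
      obtain ⟨h3, h4⟩ := @finite_RRSpace_add_single _ _ _ _ _ _ _ P h1
      rw [Finsupp.single_add, Finsupp.mapRange_add (by simp), deg_add, ← add_assoc]
      rw [Finsupp.mapRange_single (b := 1), Nat.cast_one, deg_single]
      exact ⟨h3, by linarith⟩

instance finite_RRSpace (D : PlaceOf k F →₀ ℤ) : FiniteDimensional k (RRSpace k F D) := by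
  have := IsCurveLike.finite_constants (k := k) (F := F)
  have h := (finite_RRSpace_add (0 : PlaceOf k F →₀ ℤ) (E := D ⊔ 0)
    le_sup_right).1
  rw [zero_add] at h
  exact Submodule.finiteDimensional_of_le (RRSpace_mono (le_sup_left : D ≤ D ⊔ 0))

theorem ell_add_deg_le {D D' : PlaceOf k F →₀ ℤ} (h : D ≤ D') :
    ell k F D' + deg k F D ≤ ell k F D + deg k F D' := by
  have := (finite_RRSpace_add D (sub_nonneg.2 h)).2
  rw [add_sub_cancel, deg_sub] at this
  linarith

theorem deg_poles_le {z : F} (hz : Transcendental k z) :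
    deg k F (poles z) ≤ Module.finrank k⟮z⟯ F := by
  refine le_trans (le_of_eq ?_) (Int.ofNat_le.2
    (sum_log_mul_degree_le hz (poles z).support fun P hP => ?_))
  · unfold deg Finsupp.sum
    push_cast
    refine Finset.sum_congr rfl fun P _ => ?_
    rw [poles_apply, max_comm, Int.ofNat_toNat]
  · rw [one_lt_v_iff]
    by_contra h
    exact Finsupp.mem_support_iff.1 hP (max_eq_left (not_lt.1 h))

theorem nsmul_poles_nonneg (x : F) (m : ℕ) : 0 ≤ m • (poles x : PlaceOf k F →₀ ℤ) :=
  nsmul_nonneg (poles_nonneg x) m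

/-- Linearly independent elements over `k(x)` produce many functions with bounded poles. -/
theorem mul_card_le_ell {x : F} (hx : Transcendental k x) {ι : Type*} [Fintype ι] {u : ι → F}
    (hu : LinearIndependent k⟮x⟯ u) {C : PlaceOf k F →₀ ℤ} (hC : ∀ i, u i ∈ RRSpace k F C)
    (A : ℕ) : (A + 1) * Fintype.card ι ≤ ell k F (A • poles x + C) := by
  have h1 : LinearIndependent k fun m : Fin (A + 1) => (AdjoinSimple.gen k x) ^ (m : ℕ) := by
    have : Transcendental k (AdjoinSimple.gen k x) := by
      rw [← transcendental_algebraMap_iff (algebraMap k⟮x⟯ F).injective]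
      simpa using hx
    have h := (Polynomial.basisMonomials k).linearIndependent.map'
      (Polynomial.aeval (AdjoinSimple.gen k x)).toLinearMap
      (LinearMap.ker_eq_bot.2 (transcendental_iff_injective.1 this))
    have e : (Polynomial.aeval (AdjoinSimple.gen k x)).toLinearMap ∘
        Polynomial.basisMonomials k = fun m : ℕ => (AdjoinSimple.gen k x) ^ m := by
      funext m; simp
    exact (e ▸ h).comp (Fin.val : Fin (A + 1) → ℕ) Fin.val_injective
  have h2 := linearIndependent_smul h1 hu
  have hmem : ∀ p : Fin (A + 1) × ι, (AdjoinSimple.gen k x) ^ (p.1 : ℕ) • u p.2 ∈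
      RRSpace k F (A • poles x + C) := fun p => by
    rw [Algebra.smul_def, map_pow, AdjoinSimple.algebraMap_gen]
    exact RRSpace_mono (add_le_add_left (nsmul_le_nsmul_left (poles_nonneg x) (by omega)) C)
      (mul_mem_RRSpace (pow_mem_RRSpace (mem_RRSpace_poles x) _) (hC p.2))
  have h3 : LinearIndependent k fun p : Fin (A + 1) × ι =>
      (⟨_, hmem p⟩ : RRSpace k F (A • poles x + C)) :=
    LinearIndependent.of_comp (RRSpace k F _).subtype h2
  simpa [ell] using h3.fintype_card_le_finrank

theorem deg_poles_eq {x : F} (hx : Transcendental k x) :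
    deg k F (poles x) = Module.finrank k⟮x⟯ F := by
  refine le_antisymm (deg_poles_le hx) ?_
  have := IsCurveLike.finite_adjoin x hx
  let u := Module.finBasis k⟮x⟯ F
  let C : PlaceOf k F →₀ ℤ := ∑ i, poles (u i)
  have hC : 0 ≤ C := Finset.sum_nonneg fun i _ => poles_nonneg _
  have hu : ∀ i, u i ∈ RRSpace k F C := fun i => RRSpace_mono
    (Finset.single_le_sum (f := fun i => poles (u i)) (fun i _ => poles_nonneg _)
      (Finset.mem_univ i)) (mem_RRSpace_poles (u i))
  by_contra! h
  let A := (ell k F 0 + deg k F C).toNat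
  have h1 := mul_card_le_ell hx u.linearIndependent hu A
  have h2 := ell_add_deg_le (add_nonneg (nsmul_poles_nonneg x A) hC)
  rw [deg_add, deg_nsmul, deg_zero] at h2
  rw [Fintype.card_fin] at h1
  have h3 : (A : ℤ) = ell k F 0 + deg k F C := Int.toNat_of_nonneg
    (add_nonneg (by positivity) (deg_nonneg hC))
  zify at h1
  have h4 := deg_nonneg (poles_nonneg x : 0 ≤ (poles x : PlaceOf k F →₀ ℤ))
  nlinarith [mul_le_mul_of_nonneg_left (Int.add_one_le_of_lt h) (Int.natCast_nonneg A)]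

theorem deg_prin {z : F} : deg k F (prin z) = 0 := by
  by_cases hz : Transcendental k z
  · have hz' : Transcendental k z⁻¹ := fun h => hz (by simpa using h.inv)
    rw [prin, deg_sub, deg_poles_eq hz, deg_poles_eq hz', adjoin_inv, sub_self]
  · rcases eq_or_ne z 0 with rfl | h0
    · simp [prin]
    · have : prin z = (0 : PlaceOf k F →₀ ℤ) := by
        ext P
        rw [prin_apply, P.v_eq_one_of_isAlgebraic (not_not.1 hz) h0]
        simp
      rw [this, deg_zero]

end Places

section Places

open WithZero

variable {k F : Type} [Field k] [Field F] [Algebra k F] [IsCurveLike k F]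

open PlaceOf DivisorOf

theorem isAlgebraic_of_mem_RRSpace_zero {f : F} (hf : f ∈ RRSpace k F 0) : IsAlgebraic k f := by
  by_contra h
  have hli := (Polynomial.basisMonomials k).linearIndependent.map'
    (Polynomial.aeval f).toLinearMap (LinearMap.ker_eq_bot.2 (transcendental_iff_injective.1 h))
  have hmem : ∀ m : ℕ, f ^ m ∈ RRSpace k F 0 := fun m => by
    simpa using pow_mem_RRSpace hf m
  have e : (Polynomial.aeval f).toLinearMap ∘ Polynomial.basisMonomials k =
      (RRSpace k F 0).subtype ∘ fun m : ℕ => ⟨f ^ m, hmem m⟩ := by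
    funext m; simp
  rw [e] at hli
  have := (hli.of_comp).finite
  exact not_finite ℕ

theorem exists_one_lt_v {x : F} (hx : Transcendental k x) : ∃ P : PlaceOf k F, 1 < P.v x := by
  by_contra! h
  exact hx (isAlgebraic_of_mem_RRSpace_zero fun P => h P)

theorem linearIndependent_constants {x : F} (hx : Transcendental k x) :
    LinearIndependent k⟮x⟯ fun i =>
      ((Module.finBasis k (RRSpace k F 0) i : RRSpace k F 0) : F) := by
  obtain ⟨P, hP⟩ := exists_one_lt_v hx
  have hx0 : x ≠ 0 := by rintro rfl; simp at hP
  have hw : P.v x⁻¹ < 1 := by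
    rw [map_inv₀]; exact inv_lt_one_of_one_lt₀ hP
  rw [← adjoin_inv]
  refine linearIndependent_adjoin _ (inv_ne_zero hx0) {P} ?_ ?_ ?_
  · simpa using hw.le
  · intro i Q _; exact (Module.finBasis k (RRSpace k F 0) i).2 Q
  · intro c hc
    set b := Module.finBasis k (RRSpace k F 0)
    have hs : (∑ i, c i • (b i : F)) = ((∑ i, c i • b i : RRSpace k F 0) : F) := by simp
    have h1 := (hc P rfl).trans_lt hw
    rw [hs] at h1
    have h0 : (∑ i, c i • b i) = 0 := by
      by_contra hne
      have := P.v_eq_one_of_isAlgebraic (isAlgebraic_of_mem_RRSpace_zero (∑ i, c i • b i).2)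
        (fun h => hne (Subtype.ext h))
      exact h1.ne this
    funext i
    exact Fintype.linearIndependent_iff.1 b.linearIndependent c h0 i

theorem ell_zero_pos : 0 < ell k F 0 := by
  rw [ell, Module.finrank_pos_iff]
  exact ⟨⟨1, one_mem_RRSpace le_rfl⟩, 0, fun h => one_ne_zero (congrArg Subtype.val h)⟩

theorem span_RRSpace_eq_top {D : PlaceOf k F →₀ ℤ} (hD : 0 ≤ D) {x : F} (hx : Transcendental k x)
    (hgen : IntermediateField.adjoin k (RRSpace k F D : Set F) = ⊤)
    {j : ℕ} (hj : Submodule.span k⟮x⟯ (RRSpace k F ((j + 1) • D) : Set F) ≤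
      Submodule.span k⟮x⟯ (RRSpace k F (j • D) : Set F)) :
    Submodule.span k⟮x⟯ (RRSpace k F (j • D) : Set F) = ⊤ := by
  have := IsCurveLike.finite_adjoin x hx
  have hmul : ∀ f ∈ RRSpace k F D, ∀ g ∈ Submodule.span k⟮x⟯ (RRSpace k F (j • D) : Set F),
      f * g ∈ Submodule.span k⟮x⟯ (RRSpace k F (j • D) : Set F) := by
    intro f hf g hg
    apply hj
    induction hg using Submodule.span_induction with
    | mem g hg =>
      refine Submodule.subset_span ?_
      rw [succ_nsmul, mul_comm]
      exact mul_mem_RRSpace hg hf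
    | zero => simp
    | add g h _ _ hg hh => rw [mul_add]; exact add_mem hg hh
    | smul a g _ hg => rw [mul_smul_comm]; exact Submodule.smul_mem _ a hg
  have hadj : Algebra.adjoin k⟮x⟯ (RRSpace k F D : Set F) = ⊤ := by
    rw [← IntermediateField.adjoin_toSubalgebra_of_isAlgebraic
      fun f _ => Algebra.IsAlgebraic.isAlgebraic f]
    rw [eq_top_iff]
    intro f _
    have hle : IntermediateField.adjoin k (RRSpace k F D : Set F) ≤
        (IntermediateField.adjoin k⟮x⟯ (RRSpace k F D : Set F)).restrictScalars k :=
      IntermediateField.adjoin_le_iff.2 (IntermediateField.subset_adjoin _ _)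
    rw [hgen] at hle
    exact hle (IntermediateField.mem_top (x := f))
  have hmul' : ∀ f : F, ∀ g ∈ Submodule.span k⟮x⟯ (RRSpace k F (j • D) : Set F),
      f * g ∈ Submodule.span k⟮x⟯ (RRSpace k F (j • D) : Set F) := by
    intro f
    have hf : f ∈ Algebra.adjoin k⟮x⟯ (RRSpace k F D : Set F) := by rw [hadj]; trivial
    induction hf using Algebra.adjoin_induction with
    | mem f hf => exact hmul f hf
    | algebraMap a => intro g hg; rw [← Algebra.smul_def]; exact Submodule.smul_mem _ a hg
    | add f f' _ _ h h' => intro g hg; rw [add_mul]; exact add_mem (h g hg) (h' g hg)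
    | mul f f' _ _ h h' => intro g hg; rw [mul_assoc]; exact h _ (h' g hg)
  rw [eq_top_iff]
  intro f _
  rw [← mul_one f]
  exact hmul' f 1 (Submodule.subset_span (one_mem_RRSpace (nsmul_nonneg hD j)))

theorem ell_zero_le_finrank_span {D : PlaceOf k F →₀ ℤ} {x : F} (hx : Transcendental k x) :
    ell k F 0 ≤ Module.finrank k⟮x⟯ (Submodule.span k⟮x⟯ (RRSpace k F (0 • D) : Set F)) := by
  have := IsCurveLike.finite_adjoin x hx
  have h := linearIndependent_constants hx
  have hm : ∀ i, ((Module.finBasis k (RRSpace k F 0) i : RRSpace k F 0) : F) ∈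
      Submodule.span k⟮x⟯ (RRSpace k F (0 • D) : Set F) := fun i => by
    refine Submodule.subset_span ?_
    rw [zero_smul]
    exact (Module.finBasis k (RRSpace k F 0) i).2
  have h3 : LinearIndependent k⟮x⟯ fun i => (⟨_, hm i⟩ :
      Submodule.span k⟮x⟯ (RRSpace k F (0 • D) : Set F)) :=
    LinearIndependent.of_comp (Submodule.subtype _) h
  simpa [ell] using h3.fintype_card_le_finrank

theorem ell_zero_le_finrank {x : F} (hx : Transcendental k x) :
    ell k F 0 ≤ Module.finrank k⟮x⟯ F := by
  have := IsCurveLike.finite_adjoin x hx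
  exact (ell_zero_le_finrank_span (D := 0) hx).trans (Submodule.finrank_le _)

theorem span_RRSpace_eq_top_of_generates {D : PlaceOf k F →₀ ℤ} (hD : 0 ≤ D)
    {x : F} (hx : Transcendental k x)
    (hgen : IntermediateField.adjoin k (RRSpace k F D : Set F) = ⊤) :
    Submodule.span k⟮x⟯ (RRSpace k F ((Module.finrank k⟮x⟯ F - ell k F 0) • D) : Set F) = ⊤ := by
  have := IsCurveLike.finite_adjoin x hx
  have key : ∀ j : ℕ, Submodule.span k⟮x⟯ (RRSpace k F (j • D) : Set F) = ⊤ ∨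
      ell k F 0 + j ≤ Module.finrank k⟮x⟯ (Submodule.span k⟮x⟯ (RRSpace k F (j • D) : Set F)) := by
    intro j
    induction j with
    | zero => exact Or.inr (ell_zero_le_finrank_span hx)
    | succ j ih =>
      by_cases hle : Submodule.span k⟮x⟯ (RRSpace k F ((j + 1) • D) : Set F) ≤
          Submodule.span k⟮x⟯ (RRSpace k F (j • D) : Set F)
      · left
        rw [eq_top_iff, ← span_RRSpace_eq_top hD hx hgen hle]
        exact span_RRSpace_mono hD j
      · rcases ih with ih | ih
        · exact absurd (ih ▸ le_top) hle
        · right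
          have := Submodule.finrank_lt_finrank_of_lt
            (lt_of_le_not_ge (span_RRSpace_mono (x := x) hD j) hle)
          omega
  rcases key (Module.finrank k⟮x⟯ F - ell k F 0) with h | h
  · exact h
  · refine Submodule.eq_top_of_finrank_eq (le_antisymm (Submodule.finrank_le _) (le_trans ?_ h))
    omega

/-- An explicit form of Riemann's inequality. -/
theorem riemann_inequality {D : PlaceOf k F →₀ ℤ} (hD : 0 ≤ D) {x : F} (hx : Transcendental k x)
    (hgen : IntermediateField.adjoin k (RRSpace k F D : Set F) = ⊤)
    (B : PlaceOf k F →₀ ℤ) :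
    deg k F B - ell k F B ≤ (Module.finrank k⟮x⟯ F - ell k F 0 : ℤ) * deg k F D -
      Module.finrank k⟮x⟯ F := by
  have := IsCurveLike.finite_adjoin x hx
  set N := Module.finrank k⟮x⟯ F with hN
  have hcN : ell k F 0 ≤ N := ell_zero_le_finrank hx
  have htop := span_RRSpace_eq_top_of_generates hD hx hgen
  let b := Module.Basis.ofSpan htop.ge
  have := FiniteDimensional.fintypeBasisIndex b
  have hcard := Module.finrank_eq_card_basis b
  have hb : ∀ i, b i ∈ RRSpace k F ((N - ell k F 0) • D) := fun i =>
    Module.Basis.ofSpan_subset htop.ge ⟨i, rfl⟩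
  have hNpos : 0 < N := ell_zero_pos.trans_le hcN
  let A := (deg k F (B ⊔ 0)).toNat
  have hA : (A : ℤ) = deg k F (B ⊔ 0) := Int.toNat_of_nonneg (deg_nonneg le_sup_right)
  let E := A • poles x + (N - ell k F 0) • D
  have h1 : (A + 1) * N ≤ ell k F E := by
    rw [hN, hcard]; exact mul_card_le_ell hx b.linearIndependent hb A
  have hdegE : deg k F E = A * N + (N - ell k F 0 : ℤ) * deg k F D := by
    rw [deg_add, deg_nsmul, deg_nsmul, deg_poles_eq hx, Nat.cast_sub hcN]
  have h2 := ell_add_deg_le (sub_le_self E (le_sup_right : 0 ≤ B ⊔ 0))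
  rw [deg_sub] at h2
  have h3 : 0 < ell k F (E - B ⊔ 0) := by
    zify at h1 ⊢
    have : (A : ℤ) * 1 ≤ A * N :=
      mul_le_mul_of_nonneg_left (by exact_mod_cast hNpos) (by positivity)
    have : (0 : ℤ) < N := by exact_mod_cast hNpos
    linarith
  have := Module.finrank_pos_iff.1 h3
  obtain ⟨⟨p, hp⟩, hp0⟩ := exists_ne (0 : RRSpace k F (E - B ⊔ 0))
  have hp0 : p ≠ 0 := fun h => hp0 (Subtype.ext h)
  have hv : ∀ P : PlaceOf k F, P.v p = exp (log (P.v p)) := fun P =>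
    (exp_log (by simpa using hp0)).symm
  have hle : B ≤ E + prin p := fun P => by
    have h4 := hp P
    change P.v p ≤ exp _ at h4
    rw [hv P, exp_le_exp] at h4
    have h5 : B P ≤ (B ⊔ 0) P := (le_sup_left : B ≤ B ⊔ 0) P
    rw [Finsupp.sub_apply] at h4
    rw [Finsupp.add_apply, prin_apply]
    linarith
  have h6 := ell_add_deg_le hle
  have h7 : ell k F E ≤ ell k F (E + prin p) := by
    refine LinearMap.finrank_le_finrank_of_injective
      (f := ((LinearMap.mulLeft k p⁻¹).domRestrict _).codRestrict (RRSpace k F (E + prin p))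
        fun f P => ?_) ?_
    · rw [LinearMap.domRestrict_apply, LinearMap.mulLeft_apply, map_mul, map_inv₀]
      refine (mul_le_mul_right (f.2 P) _).trans (le_of_eq ?_)
      change _ * exp _ = exp _
      rw [Finsupp.add_apply E, prin_apply, hv P, ← exp_neg, ← exp_add, log_exp, add_comm]
    · intro f g hfg
      exact Subtype.ext (mul_left_cancel₀ (inv_ne_zero hp0) (congrArg Subtype.val hfg))
  rw [deg_add, deg_prin, hdegE] at h6
  zify at h1 h7
  linarith

/-- A bound for the genus of a curve in terms of a linear system generating its function field. -/
theorem genus_le {n : ℕ} (hD : 0 ≤ D) (hDn : deg k F D ≤ n) (hxD : x ∈ RRSpace k F D)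
    (hx : Transcendental k x) (hgen : IntermediateField.adjoin k (RRSpace k F D : Set F) = ⊤) :
    genus k F ≤ (n - 1) ^ 2 := by
  have hcN : ell k F 0 ≤ Module.finrank k⟮x⟯ F := ell_zero_le_finrank hx
  have hc := ell_zero_pos (k := k) (F := F)
  have hND : (Module.finrank k⟮x⟯ F : ℤ) ≤ deg k F D := by
    rw [← deg_poles_eq hx, ← sub_nonneg, ← deg_sub]
    refine deg_nonneg fun P => ?_
    have hx0 : x ≠ 0 := by rintro rfl; exact hx isAlgebraic_zero
    have h := hxD P
    change P.v x ≤ exp _ at h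
    rw [← exp_log (x := P.v x) (by simpa using hx0), exp_le_exp] at h
    have := hD P
    simp only [Finsupp.coe_zero, Pi.zero_apply, Finsupp.coe_sub, Pi.sub_apply,
      poles_apply] at this ⊢
    omega
  refine csSup_le ⟨0, 0, by simp⟩ ?_
  rintro g ⟨B, hB⟩
  have h := riemann_inequality hD hx hgen B
  zify
  zify at hcN hc
  have hn : ((n - 1 : ℕ) : ℤ) = n - 1 := by
    rw [Nat.cast_sub]; rfl
    have : (0:ℤ) < n := by linarith
    omega
  rw [hn]
  nlinarith

end Places

section Places

open WithZero

variable {k F : Type} [Field k] [Field F] [Algebra k F]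

open PlaceOf DivisorOf

theorem DimLE.trdeg_le {d : ℕ} (h : DimLE k F d) : Algebra.trdeg k F ≤ d := by
  obtain ⟨s, hs, hal⟩ := h
  have : Algebra.IsAlgebraic (Algebra.adjoin k (s : Set F)) F := by
    exact isAlgebraic_adjoin_iff_top.1 hal
  refine (Algebra.IsAlgebraic.trdeg_le_cardinalMk k (s : Set F)).trans ?_
  simpa using hs

theorem isAlgebraic_adjoin_of_trdeg_le_one (h : Algebra.trdeg k F ≤ 1) {z : F}
    (hz : Transcendental k z) : Algebra.IsAlgebraic k⟮z⟯ F := by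
  have h1 : AlgebraicIndependent k ![z] :=
    (algebraicIndependent_unique_type_iff (ι := Fin 1)).2 (by simpa using hz)
  have h2 := (h1.isTranscendenceBasis_of_trdeg_le_of_finite (by simpa using h)).isAlgebraic_field
  rwa [Matrix.range_cons, Matrix.range_empty, Set.union_empty] at h2

theorem finiteDimensional_adjoin_of_trdeg_le_one (hfg : IsFunctionField k F)
    (h : Algebra.trdeg k F ≤ 1) {z : F} (hz : Transcendental k z) :
    FiniteDimensional k⟮z⟯ F := by
  have hal := isAlgebraic_adjoin_of_trdeg_le_one h hz
  obtain ⟨s, hs⟩ := hfg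
  have hfin : FiniteDimensional k⟮z⟯ (IntermediateField.adjoin k⟮z⟯ (s : Set F)) :=
    finiteDimensional_adjoin fun x _ => (hal.isAlgebraic x).isIntegral
  have htop : IntermediateField.adjoin k⟮z⟯ (s : Set F) = ⊤ := by
    rw [eq_top_iff]
    intro f _
    have hle : IntermediateField.adjoin k (s : Set F) ≤
        (IntermediateField.adjoin k⟮z⟯ (s : Set F)).restrictScalars k :=
      IntermediateField.adjoin_le_iff.2 (IntermediateField.subset_adjoin _ _)
    rw [hs] at hle
    exact hle (IntermediateField.mem_top (x := f))
  rw [htop] at hfin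
  exact Module.Finite.equiv IntermediateField.topEquiv.toLinearEquiv

theorem genus_eq_zero_of_not_finite (h : ¬ FiniteDimensional k (RRSpace k F 0)) :
    genus k F = 0 := by
  have hell : ∀ D : PlaceOf k F →₀ ℤ, 0 ≤ D → ell k F D = 0 := fun D hD =>
    Module.finrank_of_not_finite fun hfin =>
      h (Submodule.finiteDimensional_of_le (RRSpace_mono hD))
  by_cases hdeg : ∃ P : PlaceOf k F, P.degree ≠ 0
  · obtain ⟨P, hP⟩ := hdeg
    apply Nat.sSup_of_not_bddAbove
    rintro ⟨b, hb⟩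
    have hmem := hb (a := (b + 1) * P.degree) ⟨Finsupp.single P (b + 1), by
      rw [hell _ le_rfl, hell _ (by rw [Finsupp.single_nonneg]; positivity), deg_single]
      push_cast; ring⟩
    have : 0 < P.degree := Nat.pos_of_ne_zero hP
    nlinarith
  · push Not at hdeg
    rw [← Nat.le_zero]
    refine csSup_le ⟨0, 0, by simp⟩ ?_
    rintro g ⟨D, hD⟩
    have : deg k F D = 0 := Finset.sum_eq_zero fun P _ => by simp [hdeg P]
    rw [this, hell 0 le_rfl] at hD
    omega

end Places

section Transcendence

open WithZero

variable {k : Type} [Field k]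

theorem AlgebraicIndependent.injective_of_trdeg_le {ι B B' : Type} [Finite ι] [CommRing B]
    [IsDomain B] [CommRing B'] [Algebra k B] [Algebra k B'] (f : B →ₐ[k] B') {x : ι → B}
    (hx : AlgebraicIndependent k (f ∘ x)) (h : Algebra.trdeg k B ≤ Cardinal.mk ι) :
    Function.Injective f := by
  have hxB : AlgebraicIndependent k x := hx.of_comp f
  have hbas := hxB.isTranscendenceBasis_of_trdeg_le_of_finite h
  rw [injective_iff_map_eq_zero]
  intro b hb
  by_contra hb0
  have hal : IsAlgebraic (Algebra.adjoin k (Set.range x)) b := hbas.isAlgebraic.isAlgebraic b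
  obtain ⟨r, hr0, hr⟩ := hal.exists_nonzero_dvd (mem_nonZeroDivisors_of_ne_zero hb0)
  have hfr : f (r : B) = 0 := by
    obtain ⟨c, hc⟩ := hr
    have : (r : B) = b * c := hc
    rw [this, map_mul, hb, zero_mul]
  have hr1 : (r : B) ∈ (MvPolynomial.aeval (R := k) x).range := by
    rw [← Algebra.adjoin_range_eq_range_aeval]; exact r.2
  obtain ⟨p, hp⟩ := hr1
  have hp' : MvPolynomial.aeval x p = (r : B) := hp
  have hp0 : MvPolynomial.aeval (f ∘ x) p = 0 := by
    exact (MvPolynomial.comp_aeval_apply x f p).symm.trans (by rw [hp', hfr])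
  have := (injective_iff_map_eq_zero _).1 hx p hp0
  apply hr0
  rw [this, map_zero] at hp'
  exact Subtype.ext hp'.symm

theorem exists_ker_eq_span {σ Y T : Type} [Finite σ] [Field Y] [Algebra k Y]
    [CommRing T] [IsDomain T] [Algebra k T] (hY : Algebra.trdeg k Y ≤ 1)
    (f : MvPolynomial σ Y →ₐ[k] T) (hf : AlgebraicIndependent k fun i => f (MvPolynomial.X i)) :
    ∃ Q : MvPolynomial σ Y, RingHom.ker f = Ideal.span {Q} := by
  by_cases hbot : RingHom.ker f = ⊥
  · exact ⟨0, by simp [hbot]⟩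
  have hprime : (RingHom.ker f).IsPrime := RingHom.ker_isPrime f
  obtain ⟨Q, hQ, hQp⟩ := hprime.exists_mem_prime_of_ne_bot hbot
  refine ⟨Q, le_antisymm ?_ (by simpa [Ideal.span_le] using hQ)⟩
  have hspan : (Ideal.span {Q}).IsPrime := (Ideal.span_singleton_prime hQp.ne_zero).2 hQp
  have htr : Algebra.trdeg k (MvPolynomial σ Y) ≤ Cardinal.mk σ + 1 := by
    rw [← trdeg_add_eq (R := k) (S := Y), MvPolynomial.trdeg_of_isDomain,
      Cardinal.lift_id, add_comm]
    gcongr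
  have hquot : Algebra.trdeg k (MvPolynomial σ Y ⧸ Ideal.span {Q}) ≤ Cardinal.mk σ := by
    by_contra! hlt
    have hle : Cardinal.mk σ + 1 ≤ Algebra.trdeg k (MvPolynomial σ Y ⧸ Ideal.span {Q}) := by
      rw [← Cardinal.succ_eq_of_lt_aleph0 (Cardinal.mk_lt_aleph0 (α := σ))]
      exact Order.succ_le_of_lt hlt
    obtain ⟨s, hs⟩ := exists_isTranscendenceBasis k (MvPolynomial σ Y ⧸ Ideal.span {Q})
    have hcard := hs.cardinalMk_eq_trdeg
    have hsle : Cardinal.mk s ≤ Cardinal.mk σ + 1 := by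
      rw [hcard]
      exact (trdeg_le_of_surjective (Ideal.Quotient.mkₐ k (Ideal.span {Q}))
        (Ideal.Quotient.mkₐ_surjective k _)).trans htr
    have : Finite s := Cardinal.lt_aleph0_iff_finite.1
      (hsle.trans_lt (Cardinal.add_lt_aleph0 (Cardinal.mk_lt_aleph0) Cardinal.one_lt_aleph0))
    choose x hx using fun i : s =>
      Ideal.Quotient.mkₐ_surjective k (Ideal.span {Q}) (i : MvPolynomial σ Y ⧸ Ideal.span {Q})
    have hinj := AlgebraicIndependent.injective_of_trdeg_le
      (Ideal.Quotient.mkₐ k (Ideal.span {Q})) (x := x)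
      (by rw [show Ideal.Quotient.mkₐ k (Ideal.span {Q}) ∘ x = Subtype.val from funext hx]
          exact hs.1)
      (htr.trans (hle.trans hcard.ge))
    apply hQp.ne_zero
    apply hinj
    rw [map_zero]
    exact Ideal.Quotient.eq_zero_iff_mem.2 (Ideal.mem_span_singleton_self Q)
  let fbar : (MvPolynomial σ Y ⧸ Ideal.span {Q}) →ₐ[k] T :=
    Ideal.Quotient.liftₐ (Ideal.span {Q}) f fun a ha => by
      have : Ideal.span {Q} ≤ RingHom.ker f := by simpa [Ideal.span_le] using hQ
      exact this ha
  have hinj : Function.Injective fbar :=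
    AlgebraicIndependent.injective_of_trdeg_le fbar
      (x := fun i => Ideal.Quotient.mkₐ k (Ideal.span {Q}) (MvPolynomial.X i)) hf hquot
  intro a ha
  rw [← Ideal.Quotient.eq_zero_iff_mem]
  apply hinj
  rw [map_zero]
  exact ha

end Transcendence

section CoefficientwiseProjection

open WithZero

open MvPolynomial

variable {σ F Y : Type} [Field F] [Field Y] [Algebra F Y]

theorem LinearIndependent.exists_dual {ι V : Type} [Fintype ι] [DecidableEq ι] [AddCommGroup V]
    [Module F V] {y : ι → V} (hy : LinearIndependent F y) :
    ∃ π : ι → V →ₗ[F] F, (∀ i j, π j (y i) = if i = j then 1 else 0) ∧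
      ∀ x ∈ Submodule.span F (Set.range y), ∑ j, π j x • y j = x := by
  obtain ⟨g, hg⟩ := LinearMap.exists_leftInverse_of_injective (Fintype.linearCombination F y)
    (LinearMap.ker_eq_bot.2 hy.fintypeLinearCombination_injective)
  have hπ : ∀ i j, (LinearMap.proj j ∘ₗ g) (y i) = if i = j then (1 : F) else 0 := by
    intro i j
    have h := LinearMap.congr_fun hg (Pi.single i 1)
    simp only [LinearMap.comp_apply, Fintype.linearCombination_apply_single, one_smul,
      LinearMap.id_apply] at h
    simp only [LinearMap.comp_apply, h, LinearMap.proj_apply, Pi.single_apply, eq_comm]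
  refine ⟨fun j => LinearMap.proj j ∘ₗ g, hπ, fun x hx => ?_⟩
  obtain ⟨c, rfl⟩ := (Submodule.mem_span_range_iff_exists_fun F).1 hx
  refine Finset.sum_congr rfl fun j _ => ?_
  rw [map_sum]
  simp [hπ, -LinearMap.coe_comp, -Function.comp_apply]

/-- Apply a linear functional to every coefficient of a polynomial. -/
noncomputable def coeffMap (π : Y →ₗ[F] F) (p : MvPolynomial σ Y) : MvPolynomial σ F :=
  ∑ α ∈ p.support, monomial α (π (coeff α p))

theorem coeff_coeffMap (π : Y →ₗ[F] F) (p : MvPolynomial σ Y) (α : σ →₀ ℕ) :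
    coeff α (coeffMap π p) = π (coeff α p) := by
  classical
  rw [coeffMap, coeff_sum]
  simp only [coeff_monomial, Finset.sum_ite_eq', mem_support_iff]
  split_ifs with h
  · rfl
  · rw [not_not.1 h, map_zero]

theorem coeffMap_map_mul (π : Y →ₗ[F] F) (q : MvPolynomial σ F) (u : MvPolynomial σ Y) :
    coeffMap π (map (algebraMap F Y) q * u) = q * coeffMap π u := by
  classical
  ext α
  simp only [coeff_coeffMap, coeff_mul, coeff_map, map_sum, ← Algebra.smul_def, map_smul,
    smul_eq_mul]

end CoefficientwiseProjection

section Rank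

open WithZero

set_option linter.unusedSectionVars false

open MvPolynomial

variable {k σ F Y T : Type} [Field k] [Field F] [Field Y] [Field T]
  [Algebra k F] [Algebra F Y] [Algebra k Y] [IsScalarTower k F Y]
  [Algebra F T] [Algebra Y T] [Algebra k T] [IsScalarTower F Y T] [IsScalarTower k Y T]
  [IsScalarTower k F T]
  [Algebra (MvPolynomial σ k) T] [IsScalarTower k (MvPolynomial σ k) T]

variable (k σ F T) in
/-- The `F`-algebra map `F[X] → T` that agrees with `k[X] → T` on the variables. -/
noncomputable def extendEval : MvPolynomial σ F →ₐ[F] T :=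
  aeval fun i => algebraMap (MvPolynomial σ k) T (X i)

theorem extendEval_map (p : MvPolynomial σ k) :
    extendEval k σ F T (map (algebraMap k F) p) = algebraMap (MvPolynomial σ k) T p := by
  rw [extendEval, aeval_map_algebraMap]
  exact (aeval_unique (IsScalarTower.toAlgHom k (MvPolynomial σ k) T)).symm ▸ rfl

theorem extendEval_map_base (p : MvPolynomial σ F) :
    extendEval k σ Y T (map (algebraMap F Y) p) = extendEval k σ F T p := by
  rw [extendEval, aeval_map_algebraMap]
  rfl

theorem extendEval_C (a : F) : extendEval k σ F T (C a) = algebraMap F T a :=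
  aeval_C _ _

theorem extendEval_eq_zero {Q : MvPolynomial σ F}
    (hQ : RingHom.ker (extendEval k σ Y T) = Ideal.span {map (algebraMap F Y) Q}) :
    extendEval k σ F T Q = 0 := by
  rw [← extendEval_map_base (Y := Y), ← RingHom.mem_ker, hQ]
  exact Ideal.mem_span_singleton_self _

theorem dvd_of_extendEval_eq_zero {Q : MvPolynomial σ F}
    (hQ : RingHom.ker (extendEval k σ Y T) = Ideal.span {map (algebraMap F Y) Q})
    {p : MvPolynomial σ F} (hp : extendEval k σ F T p = 0) : Q ∣ p := by
  rw [← extendEval_map_base (Y := Y), ← RingHom.mem_ker, hQ, Ideal.mem_span_singleton] at hp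
  obtain ⟨u, hu⟩ := hp
  obtain ⟨π, hπ, -⟩ := (LinearIndependent.of_subsingleton (R := F) (v := fun _ : Unit => (1 : Y))
    () one_ne_zero).exists_dual
  refine ⟨coeffMap (π ()) u, ?_⟩
  rw [← coeffMap_map_mul, ← hu]
  ext α
  rw [coeff_coeffMap, coeff_map, Algebra.algebraMap_eq_smul_one, map_smul, hπ () ()]
  simp

theorem linearIndependent_algebraMap [FaithfulSMul (MvPolynomial σ k) T] {Q : MvPolynomial σ F}
    (hQ : RingHom.ker (extendEval k σ Y T) = Ideal.span {map (algebraMap F Y) Q})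
    {ι : Type} [Fintype ι] {y : ι → Y} (hy : LinearIndependent F y) :
    LinearIndependent (MvPolynomial σ k) fun i => algebraMap Y T (y i) := by
  classical
  obtain ⟨π, hπ, -⟩ := hy.exists_dual
  rw [Fintype.linearIndependent_iff]
  intro c hc j
  have hmem : extendEval k σ Y T (∑ i, C (y i) * map (algebraMap k Y) (c i)) = 0 := by
    rw [← hc, map_sum]
    exact Finset.sum_congr rfl fun i _ => by
      rw [map_mul, extendEval_map, extendEval_C, Algebra.smul_def, mul_comm]
  rw [← RingHom.mem_ker, hQ, Ideal.mem_span_singleton] at hmem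
  obtain ⟨u, hu⟩ := hmem
  have hj : map (algebraMap k F) (c j) = Q * coeffMap (π j) u := by
    rw [← coeffMap_map_mul, ← hu]
    ext α
    simp only [coeff_coeffMap, coeff_sum, coeff_C_mul, coeff_map, map_sum]
    simp only [mul_comm (y _), IsScalarTower.algebraMap_apply k F Y, ← Algebra.smul_def, map_smul,
      hπ]
    simp
  have h0 := congrArg (extendEval k σ F T) hj
  rw [extendEval_map, map_mul, extendEval_eq_zero hQ, zero_mul] at h0
  exact (FaithfulSMul.algebraMap_injective (MvPolynomial σ k) T) (by rw [h0, map_zero])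

theorem rank_le_of_ker_extendEval [FaithfulSMul (MvPolynomial σ k) T] {Q : MvPolynomial σ F}
    (hQ : RingHom.ker (extendEval k σ Y T) = Ideal.span {map (algebraMap F Y) Q})
    {n : ℕ} (hn : Module.rank (MvPolynomial σ k) T ≤ n) : Module.rank F Y ≤ n := by
  refine rank_le fun s hs => ?_
  have h := (linearIndependent_algebraMap hQ hs).cardinal_le_rank
  simpa using h.trans hn

end Rank

section Gauss

open WithZero

open MvPolynomial

variable {σ F Γ : Type} [Field F] [LinearOrderedCommGroupWithZero Γ] (v : Valuation F Γ)

theorem MvPolynomial.exists_map_valuationSubring {p : MvPolynomial σ F}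
    (hp : ∀ α, v (coeff α p) ≤ 1) :
    ∃ p' : MvPolynomial σ v.valuationSubring, map (algebraMap v.valuationSubring F) p' = p := by
  have : p ∈ Set.range (map (σ := σ) (algebraMap v.valuationSubring F)) := by
    rw [mem_range_map_iff_coeffs_subset]
    intro c hc
    obtain ⟨α, -, rfl⟩ := mem_coeffs_iff.1 hc
    exact ⟨⟨_, hp α⟩, rfl⟩
  exact this

theorem MvPolynomial.exists_valuation_coeff_mul_eq_one {p q : MvPolynomial σ F} {α β : σ →₀ ℕ}
    (hp : ∀ α, v (coeff α p) ≤ 1) (hα : v (coeff α p) = 1)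
    (hq : ∀ α, v (coeff α q) ≤ 1) (hβ : v (coeff β q) = 1) :
    ∃ γ, v (coeff γ (p * q)) = 1 := by
  obtain ⟨p, rfl⟩ := exists_map_valuationSubring v hp
  obtain ⟨q, rfl⟩ := exists_map_valuationSubring v hq
  have key : ∀ (r : MvPolynomial σ v.valuationSubring) (γ : σ →₀ ℕ),
      coeff γ (map (IsLocalRing.residue v.valuationSubring) r) ≠ 0 ↔
        v (coeff γ (map (algebraMap v.valuationSubring F) r)) = 1 := by
    intro r γ
    rw [coeff_map, coeff_map, IsLocalRing.residue_ne_zero_iff_isUnit,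
      Valuation.Integers.isUnit_iff_valuation_eq_one (Valuation.valuationSubring.integers (v := v))]
  have hp0 : map (IsLocalRing.residue v.valuationSubring) p ≠ 0 := fun h =>
    (key p α).2 hα (by rw [h, coeff_zero])
  have hq0 : map (IsLocalRing.residue v.valuationSubring) q ≠ 0 := fun h =>
    (key q β).2 hβ (by rw [h, coeff_zero])
  obtain ⟨γ, hγ⟩ := ne_zero_iff.1 (mul_ne_zero hp0 hq0)
  refine ⟨γ, ?_⟩
  rw [← map_mul] at hγ ⊢
  exact (key _ γ).1 hγ

theorem MvPolynomial.exists_normalize {p : MvPolynomial σ F} (hp : p ≠ 0) :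
    ∃ α, coeff α p ≠ 0 ∧ ∀ β, v (coeff β p) ≤ v (coeff α p) := by
  obtain ⟨α, hα, hmax⟩ := p.support.exists_max_image (fun β => v (coeff β p))
    (support_nonempty.2 hp)
  refine ⟨α, mem_support_iff.1 hα, fun β => ?_⟩
  by_cases hβ : β ∈ p.support
  · exact hmax β hβ
  · simp [notMem_support_iff.1 hβ]

/-- **Gauss's lemma** for a valuation. -/
theorem MvPolynomial.exists_le_valuation_coeff_mul (p q : MvPolynomial σ F) (α β : σ →₀ ℕ) :
    ∃ γ, v (coeff α p) * v (coeff β q) ≤ v (coeff γ (p * q)) := by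
  by_cases hp : p = 0
  · exact ⟨0, by simp [hp]⟩
  by_cases hq : q = 0
  · exact ⟨0, by simp [hq]⟩
  obtain ⟨α', hα', hα⟩ := exists_normalize v hp
  obtain ⟨β', hβ', hβ⟩ := exists_normalize v hq
  have hle : ∀ {r : MvPolynomial σ F} {γ'}, coeff γ' r ≠ 0 →
      (∀ γ, v (coeff γ r) ≤ v (coeff γ' r)) →
      ∀ γ, v (coeff γ (C (coeff γ' r)⁻¹ * r)) ≤ 1 := by
    intro r γ' h0 h γ
    rw [coeff_C_mul, map_mul, map_inv₀, ← div_eq_inv_mul]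
    exact div_le_one_of_le₀ (h γ) zero_le
  have heq : ∀ {r : MvPolynomial σ F} {γ'}, coeff γ' r ≠ 0 →
      v (coeff γ' (C (coeff γ' r)⁻¹ * r)) = 1 := by
    intro r γ' h0
    rw [coeff_C_mul, inv_mul_cancel₀ h0, map_one]
  obtain ⟨γ, hγ⟩ := exists_valuation_coeff_mul_eq_one v (hle hα' hα) (heq hα') (hle hβ' hβ)
    (heq hβ')
  refine ⟨γ, (mul_le_mul' (hα α) (hβ β)).trans_eq ?_⟩
  rw [mul_mul_mul_comm, ← C_mul, coeff_C_mul, ← mul_inv, map_mul, map_inv₀, map_mul] at hγ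
  exact (inv_mul_eq_one₀ (mul_ne_zero (by simpa using hα') (by simpa using hβ'))).1 hγ

end Gauss

section Places

open WithZero

open MvPolynomial PlaceOf DivisorOf

variable {k F : Type} [Field k] [Field F] [Algebra k F]

theorem exists_coeff_divisor [IsCurveLike k F] (s : Finset F) (hs : 1 ∈ s) :
    ∃ D : PlaceOf k F →₀ ℤ, 0 ≤ D ∧ (∀ f ∈ s, f ∈ RRSpace k F D) ∧
      ∀ P : PlaceOf k F, ∃ f ∈ s, exp (D P) = P.v f := by
  have key : ∃ D : PlaceOf k F →₀ ℤ, (∀ f ∈ s, poles f ≤ D) ∧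
      ∀ P : PlaceOf k F, ∃ f ∈ s, D P = poles f P := by
    have hne : s.Nonempty := ⟨1, hs⟩
    clear hs
    induction hne using Finset.Nonempty.cons_induction with
    | singleton f => exact ⟨poles f, by simp, by simp⟩
    | cons f s hf _ ih =>
      obtain ⟨D, h1, h2⟩ := ih
      refine ⟨poles f ⊔ D, ?_, fun P => ?_⟩
      · simp only [Finset.mem_cons, forall_eq_or_imp]
        exact ⟨le_sup_left, fun g hg => (h1 g hg).trans le_sup_right⟩
      · obtain ⟨g, hg, h⟩ := h2 P
        rw [Finsupp.sup_apply]
        rcases max_choice (poles f P) (D P) with h3 | h3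
        · exact ⟨f, Finset.mem_cons_self f s, h3⟩
        · exact ⟨g, Finset.mem_cons_of_mem hg, h3.trans h⟩
  obtain ⟨D, hD, hP⟩ := key
  have hD0 : 0 ≤ D := (poles_nonneg 1).trans (hD 1 hs)
  refine ⟨D, hD0, fun f hf => RRSpace_mono (hD f hf) (mem_RRSpace_poles f), fun P => ?_⟩
  obtain ⟨f, hf, h⟩ := hP P
  rcases (hD0 P).eq_or_lt with h0 | h0
  · exact ⟨1, hs, by rw [← h0, map_one]; rfl⟩
  · refine ⟨f, hf, ?_⟩
    rw [Finsupp.coe_zero, Pi.zero_apply, h, poles_apply, lt_max_iff] at h0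
    have h1 : 0 < log (P.v f) := h0.resolve_left (lt_irrefl _)
    rw [h, poles_apply, max_eq_right h1.le, exp_log]
    intro h2
    simp [h2] at h1

end Places

section DegreeBound

open WithZero

open MvPolynomial PlaceOf DivisorOf

attribute [local instance] MvPolynomial.algebraMvPolynomial

variable {k F : Type} [Field k] [Field F] [Algebra k F] {σ : Type}

theorem MvPolynomial.smul_eq_map_mul (p : MvPolynomial σ k) (q : MvPolynomial σ F) :
    p • q = map (algebraMap k F) p * q :=
  Algebra.smul_def p q

theorem MvPolynomial.coeff_linearCombination_C {ι : Type} [Fintype ι] (b : ι → F)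
    (c : ι → MvPolynomial σ k) (α : σ →₀ ℕ) :
    coeff α (Fintype.linearCombination (MvPolynomial σ k) (fun i => (C (b i) : MvPolynomial σ F)) c)
      = ∑ i, coeff α (c i) • b i := by
  rw [Fintype.linearCombination_apply, coeff_sum]
  refine Finset.sum_congr rfl fun i _ => ?_
  rw [smul_eq_map_mul, mul_comm, coeff_C_mul, coeff_map, Algebra.smul_def, mul_comm]

theorem MvPolynomial.linearCombination_C_injective {ι : Type} [Fintype ι] {b : ι → F}
    (hb : LinearIndependent k b) : Function.Injective
      (Fintype.linearCombination (MvPolynomial σ k) fun i => (C (b i) : MvPolynomial σ F)) := by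
  rw [injective_iff_map_eq_zero]
  intro c hc
  funext i
  ext α
  have h := coeff_linearCombination_C b c α
  rw [hc, coeff_zero, eq_comm] at h
  exact Fintype.linearIndependent_iff.1 hb _ h i

theorem MvPolynomial.mem_range_linearCombination_C {ι : Type} [Fintype ι] {b : ι → F}
    (hb : LinearIndependent k b) {u : MvPolynomial σ F}
    (hu : ∀ α, coeff α u ∈ Submodule.span k (Set.range b)) : ∃ c,
      Fintype.linearCombination (MvPolynomial σ k) (fun i => (C (b i) : MvPolynomial σ F)) c =
        u := by
  classical
  obtain ⟨π, -, hπ⟩ := hb.exists_dual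
  refine ⟨fun i => coeffMap (π i) u, ?_⟩
  ext α
  rw [coeff_linearCombination_C]
  simp only [coeff_coeffMap]
  exact hπ _ (hu α)

/-- Multiplication by a relation `Q` between elements of `F` and a transcendence basis bounds the
growth of Riemann–Roch spaces. -/
theorem ell_add_le_of_relation [IsCurveLike k F] {T : Type} [Field T] [Algebra k T] [Algebra F T]
    [IsScalarTower k F T] [Algebra (MvPolynomial σ k) T] [IsScalarTower k (MvPolynomial σ k) T]
    {Q : MvPolynomial σ F} (hQ : ∀ p, extendEval k σ F T p = 0 → Q ∣ p) {n : ℕ}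
    (hn : Module.rank (MvPolynomial σ k) T ≤ n) {D : PlaceOf k F →₀ ℤ}
    (hD : ∀ P : PlaceOf k F, ∃ α, exp (D P) = P.v (coeff α Q)) (B : PlaceOf k F →₀ ℤ) :
    ell k F (B + D) ≤ ell k F B + n := by
  let f : Fin (ell k F (B + D)) → F := fun i => (Module.finBasis k (RRSpace k F (B + D)) i : F)
  let b : Fin (ell k F B) → F := fun i => (Module.finBasis k (RRSpace k F B) i : F)
  have hf : LinearIndependent k f :=
    (Module.finBasis k (RRSpace k F (B + D))).linearIndependent.map'
    (RRSpace k F (B + D)).subtype (Submodule.ker_subtype _)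
  have hb : LinearIndependent k b := (Module.finBasis k (RRSpace k F B)).linearIndependent.map'
    (RRSpace k F B).subtype (Submodule.ker_subtype _)
  have hbspan : Submodule.span k (Set.range b) = RRSpace k F B := by
    have := congrArg (Submodule.map (RRSpace k F B).subtype)
      (Module.finBasis k (RRSpace k F B)).span_eq
    rwa [Submodule.map_span, Submodule.map_subtype_top, ← Set.range_comp] at this
  let R := MvPolynomial σ k
  let Θ := Fintype.linearCombination R fun i => (C (f i) : MvPolynomial σ F)
  let Λ := (LinearMap.mulLeft R Q).comp
    (Fintype.linearCombination R fun i => (C (b i) : MvPolynomial σ F))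
  let Ψ := Fintype.linearCombination R fun i => algebraMap F T (f i)
  have hΨ : ∀ c, Ψ c = extendEval k σ F T (Θ c) := by
    intro c
    simp only [Ψ, Θ, Fintype.linearCombination_apply, map_sum]
    refine Finset.sum_congr rfl fun i _ => ?_
    rw [MvPolynomial.smul_eq_map_mul, map_mul, extendEval_map, extendEval_C, Algebra.smul_def]
  have hker : (LinearMap.ker Ψ).map Θ ≤ LinearMap.range Λ := by
    rintro _ ⟨c, hc, rfl⟩
    obtain ⟨u, hu⟩ := hQ (Θ c) (by rw [← hΨ]; exact hc)
    have hcoeff : ∀ α, coeff α u ∈ Submodule.span k (Set.range b) := by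
      intro β
      rw [hbspan, mem_RRSpace]
      intro P
      obtain ⟨α, hα⟩ := hD P
      obtain ⟨γ, hγ⟩ := MvPolynomial.exists_le_valuation_coeff_mul P.v Q u α β
      have hmem : coeff γ (Q * u) ∈ RRSpace k F (B + D) := by
        rw [← hu, coeff_linearCombination_C]
        exact Submodule.sum_mem _ fun i _ => Submodule.smul_mem _ _ (Subtype.prop _)
      have hle := hγ.trans (mem_RRSpace.1 hmem P)
      rw [← hα, Finsupp.add_apply, add_comm, exp_add] at hle
      exact le_of_mul_le_mul_left hle exp_pos
    obtain ⟨e, rfl⟩ := mem_range_linearCombination_C hb hcoeff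
    exact ⟨e, hu.symm⟩
  have hrank : Module.rank R (LinearMap.ker Ψ) ≤ ell k F B := by
    rw [((LinearMap.ker Ψ).equivMapOfInjective Θ (linearCombination_C_injective hf)).rank_eq]
    refine (Submodule.rank_mono hker).trans ((rank_range_le Λ).trans ?_)
    rw [rank_fin_fun]
  have hsum := LinearMap.rank_range_add_rank_ker Ψ
  rw [rank_fin_fun] at hsum
  have : ((ell k F (B + D) : ℕ) : Cardinal) ≤ ((n + ell k F B : ℕ) : Cardinal) := by
    rw [← hsum, Nat.cast_add]
    exact add_le_add ((Submodule.rank_le _).trans hn) hrank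
  rw [add_comm (ell k F B)]
  exact_mod_cast this

end DegreeBound

section Places

open WithZero

open PlaceOf DivisorOf

variable {k F : Type} [Field k] [Field F] [Algebra k F] [IsCurveLike k F]

theorem deg_le_of_ell_add_le {D : PlaceOf k F →₀ ℤ} (hD : 0 ≤ D) {n : ℕ}
    (h : ∀ B, ell k F (B + D) ≤ ell k F B + n) {x : F} (hx : Transcendental k x)
    (hgen : IntermediateField.adjoin k (RRSpace k F D : Set F) = ⊤) : deg k F D ≤ n := by
  have hell : ∀ j : ℕ, ell k F (j • D) ≤ ell k F 0 + j * n := by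
    intro j
    induction j with
    | zero => simp
    | succ j ih =>
      rw [succ_nsmul]
      refine (h _).trans ?_
      linarith
  by_contra! hlt
  obtain ⟨C, hC⟩ : ∃ C : ℤ, ∀ B, deg k F B - ell k F B ≤ C :=
    ⟨_, riemann_inequality hD hx hgen⟩
  have h1 := hC ((C + ell k F 0 + 1).toNat • D)
  have h2 := hell (C + ell k F 0 + 1).toNat
  rw [deg_nsmul] at h1
  have h3 : C + ell k F 0 + 1 ≤ ((C + ell k F 0 + 1).toNat : ℤ) := Int.self_le_toNat _
  zify at h2
  nlinarith

end Places

section Relation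

open WithZero

open MvPolynomial PlaceOf DivisorOf

variable {k F : Type} [Field k] [Field F] [Algebra k F] {σ : Type}

theorem genus_le_of_relation {T : Type} [Field T] [Algebra k T] [Algebra F T]
    [IsScalarTower k F T] [Algebra (MvPolynomial σ k) T] [IsScalarTower k (MvPolynomial σ k) T]
    (hfg : IsFunctionField k F) (htr : Algebra.trdeg k F ≤ 1)
    {Q : MvPolynomial σ F} (hQ : ∀ p, extendEval k σ F T p = 0 → Q ∣ p)
    (hone : 1 ∈ Q.coeffs) {x : F} (hxQ : x ∈ Q.coeffs) (hx : Transcendental k x)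
    (hgen : IntermediateField.adjoin k (Q.coeffs : Set F) = ⊤) {n : ℕ}
    (hn : Module.rank (MvPolynomial σ k) T ≤ n) : genus k F ≤ (n - 1) ^ 2 := by
  by_cases hconst : FiniteDimensional k (RRSpace k F 0)
  · have : IsCurveLike k F :=
      ⟨fun z hz => finiteDimensional_adjoin_of_trdeg_le_one hfg htr hz, hconst⟩
    obtain ⟨D, hD0, hD, hDP⟩ := exists_coeff_divisor (k := k) Q.coeffs hone
    have hgenD : IntermediateField.adjoin k (RRSpace k F D : Set F) = ⊤ := by
      rw [← top_le_iff, ← hgen]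
      exact IntermediateField.adjoin.mono _ _ _ fun f hf => hD f hf
    have hell := ell_add_le_of_relation hQ hn (D := D) fun P => by
      obtain ⟨f, hf, h⟩ := hDP P
      obtain ⟨α, -, rfl⟩ := mem_coeffs_iff.1 hf
      exact ⟨α, h⟩
    exact genus_le hD0 (deg_le_of_ell_add_le hD0 hell hx hgenD) (hD x hxQ) hx hgenD
  · simp [genus_eq_zero_of_not_finite hconst]

end Relation

section Equivariance

open WithZero

open MvPolynomial

variable {k σ Y T : Type} [Field k] [Field Y] [Field T]
  [Algebra k Y] [Algebra Y T] [Algebra k T] [IsScalarTower k Y T]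
  [Algebra (MvPolynomial σ k) T] [IsScalarTower k (MvPolynomial σ k) T]

theorem algebraicIndependent_algebraMap_X [FaithfulSMul (MvPolynomial σ k) T] :
    AlgebraicIndependent k fun i => algebraMap (MvPolynomial σ k) T (X i) := by
  have h : ⇑(aeval (R := k) fun i => algebraMap (MvPolynomial σ k) T (X i)) =
      algebraMap (MvPolynomial σ k) T :=
    congrArg DFunLike.coe (aeval_unique (IsScalarTower.toAlgHom k (MvPolynomial σ k) T)).symm
  rw [algebraicIndependent_iff_injective_aeval, h]
  exact FaithfulSMul.algebraMap_injective _ _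

/-- A normalised generator of the ideal of relations is semi-invariant, so its coefficients
generate a stable subfield. -/
theorem apply_coeff_mem_adjoin_coeffs {Q : MvPolynomial σ Y}
    (hQ : RingHom.ker (extendEval k σ Y T) = Ideal.span {Q}) {α₀ : σ →₀ ℕ} (hα₀ : coeff α₀ Q = 1)
    (τ : Y ≃ₐ[k] Y) (τT : T ≃ₐ[k] T) (e : σ ≃ σ)
    (hτ : ∀ y, τT (algebraMap Y T y) = algebraMap Y T (τ y))
    (he : ∀ i, τT (algebraMap (MvPolynomial σ k) T (X i)) =
      algebraMap (MvPolynomial σ k) T (X (e i))) (α : σ →₀ ℕ) :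
    τ (coeff α Q) ∈ IntermediateField.adjoin k (Q.coeffs : Set Y) := by
  have hmem : ∀ α, coeff α Q ∈ IntermediateField.adjoin k (Q.coeffs : Set Y) := fun α => by
    by_cases h : coeff α Q = 0
    · rw [h]; exact zero_mem _
    · exact IntermediateField.subset_adjoin _ _ (coeff_mem_coeffs α h)
  let τQ : MvPolynomial σ Y := rename e (map (τ : Y →+* Y) Q)
  have hcoeff : ∀ α, coeff (α.mapDomain e) τQ = τ (coeff α Q) := fun α => by
    rw [coeff_rename_mapDomain _ e.injective, coeff_map]; rfl
  have hcompat : ∀ p : MvPolynomial σ Y,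
      extendEval k σ Y T (rename e (map (τ : Y →+* Y) p)) = τT (extendEval k σ Y T p) := by
    intro p
    induction p using MvPolynomial.induction_on with
    | C a =>
      rw [map_C, rename_C, extendEval_C, extendEval_C, hτ]; rfl
    | add p q hp hq => rw [map_add, map_add, map_add, hp, hq, map_add, map_add]
    | mul_X p i hp =>
      rw [map_mul, map_mul, map_mul, hp, map_X, rename_X, map_mul, map_mul]
      simp only [extendEval, aeval_X, he]
  have hτQ : extendEval k σ Y T τQ = 0 := by
    rw [hcompat, ← map_zero τT]
    congr 1
    rw [← RingHom.mem_ker, hQ]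
    exact Ideal.mem_span_singleton_self Q
  rw [← RingHom.mem_ker, hQ, Ideal.mem_span_singleton] at hτQ
  obtain ⟨u, hu⟩ := hτQ
  have hτQ0 : τQ ≠ 0 := fun h => by
    have := hcoeff α₀
    rw [h, coeff_zero, hα₀, map_one] at this
    exact zero_ne_one this
  have hQ0 : Q ≠ 0 := left_ne_zero_of_mul (hu ▸ hτQ0)
  have hu0 : u ≠ 0 := right_ne_zero_of_mul (hu ▸ hτQ0)
  have hdeg : τQ.totalDegree ≤ Q.totalDegree :=
    (totalDegree_rename_le _ _).trans (Finset.sup_mono (support_map_subset _ _))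
  rw [hu, totalDegree_mul_of_isDomain hQ0 hu0] at hdeg
  have huC := totalDegree_eq_zero_iff_eq_C.1 (show u.totalDegree = 0 by omega)
  have hmul : ∀ α, τ (coeff α Q) = coeff (α.mapDomain e) Q * coeff 0 u := fun α => by
    rw [← hcoeff, hu, huC, mul_comm, coeff_C_mul, mul_comm, coeff_zero_C]
  have h1 := hmul α₀
  rw [hα₀, map_one] at h1
  rw [hmul, eq_inv_of_mul_eq_one_right h1.symm]
  exact mul_mem (hmem _) (inv_mem (hmem _))

end Equivariance

section Galois

open WithZero

variable {G k Y : Type} [Group G] [Field k] [Field Y] [Algebra k Y]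

theorem card_le_of_rank_le {n : ℕ} (hn : Module.rank k Y ≤ n) {act : G →* (Y ≃ₐ[k] Y)}
    (hact : Function.Injective act) : Nat.card G ≤ n := by
  have : FiniteDimensional k Y :=
    Module.rank_lt_aleph0_iff.1 (hn.trans_lt Cardinal.natCast_lt_aleph0)
  calc Nat.card G ≤ Nat.card (Y ≃ₐ[k] Y) := Nat.card_le_card_of_injective _ hact
    _ = Fintype.card (Y ≃ₐ[k] Y) := Nat.card_eq_fintype_card
    _ ≤ Module.finrank k Y := AlgEquiv.card_le
    _ ≤ n := Module.finrank_le_of_rank_le hn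

/-- The action on a stable intermediate field. -/
noncomputable def restrictAction (act : G →* (Y ≃ₐ[k] Y)) (F : IntermediateField k Y)
    (hF : ∀ g, ∀ y ∈ F, act g y ∈ F) : G →* (F ≃ₐ[k] F) where
  toFun g := AlgEquiv.ofAlgHom
    (((act g).toAlgHom.comp F.val).codRestrict F.toSubalgebra fun y => hF g y y.2)
    (((act g⁻¹).toAlgHom.comp F.val).codRestrict F.toSubalgebra fun y => hF g⁻¹ y y.2)
    (AlgHom.ext fun y => Subtype.ext (by
      change act g (act g⁻¹ y) = y
      rw [← AlgEquiv.mul_apply, ← map_mul, mul_inv_cancel, map_one, AlgEquiv.one_apply]))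
    (AlgHom.ext fun y => Subtype.ext (by
      change act g⁻¹ (act g y) = y
      rw [← AlgEquiv.mul_apply, ← map_mul, inv_mul_cancel, map_one, AlgEquiv.one_apply]))
  map_one' := AlgEquiv.ext fun y => Subtype.ext (by
    change act 1 y = y
    rw [map_one, AlgEquiv.one_apply])
  map_mul' g h := AlgEquiv.ext fun y => Subtype.ext (by
    change act (g * h) y = act g (act h y)
    rw [map_mul, AlgEquiv.mul_apply])

theorem restrictAction_apply (act : G →* (Y ≃ₐ[k] Y)) (F : IntermediateField k Y)
    (hF : ∀ g, ∀ y ∈ F, act g y ∈ F) (g : G) (y : F) :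
    (restrictAction act F hF g y : Y) = act g y := rfl

theorem card_le_of_restrictAction_eq_one {n : ℕ} {F : IntermediateField k Y}
    (hn : Module.rank F Y ≤ n) {act : G →* (Y ≃ₐ[k] Y)} (hact : Function.Injective act)
    (hF : ∀ g, ∀ y ∈ F, act g y ∈ F) (hone : restrictAction act F hF = 1) : Nat.card G ≤ n := by
  have hfix : ∀ g, ∀ y : F, act g y = y := fun g y => by
    rw [← restrictAction_apply act F hF, hone]; rfl
  let actF : G →* (Y ≃ₐ[F] Y) :=
    { toFun := fun g => AlgEquiv.ofRingEquiv (f := (act g).toRingEquiv) (hfix g)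
      map_one' := AlgEquiv.ext fun y => by
        change act 1 y = y
        rw [map_one, AlgEquiv.one_apply]
      map_mul' := fun g h => AlgEquiv.ext fun y => by
        change act (g * h) y = act g (act h y)
        rw [map_mul, AlgEquiv.mul_apply] }
  refine card_le_of_rank_le hn (act := actF) fun g h hgh => hact (AlgEquiv.ext fun y => ?_)
  exact AlgEquiv.congr_fun hgh y

end Galois

section Compression

open WithZero

set_option linter.unusedSectionVars false

open MvPolynomial

variable {k Y T G : Type} [Field k] [Field Y] [Field T] [Group G] [Finite G]
  [Algebra k Y] [Algebra Y T] [Algebra k T] [IsScalarTower k Y T]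
  [Algebra (MvPolynomial G k) T] [IsScalarTower k (MvPolynomial G k) T]

theorem exists_normalized_generator {σ : Type} {J : Ideal (MvPolynomial σ Y)} (hJ : J ≠ ⊥)
    (h : ∃ Q, J = Ideal.span {Q}) : ∃ Q α, coeff α Q = 1 ∧ J = Ideal.span {Q} := by
  obtain ⟨Q, rfl⟩ := h
  have hQ0 : Q ≠ 0 := fun h => hJ (by rw [h, Ideal.span_singleton_eq_bot])
  obtain ⟨α, hα⟩ := ne_zero_iff.1 hQ0
  refine ⟨C (coeff α Q)⁻¹ * Q, α, by rw [coeff_C_mul, inv_mul_cancel₀ hα], ?_⟩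
  exact (Ideal.span_singleton_mul_left_unit ((isUnit_iff_ne_zero.2 (inv_ne_zero hα)).map C) Q).symm

theorem exists_transcendental_coeff [FaithfulSMul (MvPolynomial G k) T] {F : Type} [Field F]
    [Algebra k F] [Algebra F T] [IsScalarTower k F T] {Q : MvPolynomial G F} (hQ0 : Q ≠ 0)
    (hQ : extendEval k G F T Q = 0)
    (hgen : IntermediateField.adjoin k (Q.coeffs : Set F) = ⊤) :
    ∃ x ∈ Q.coeffs, Transcendental k x := by
  by_contra! hal
  have : Algebra.IsAlgebraic k (⊤ : IntermediateField k F) := by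
    rw [← hgen]
    exact IntermediateField.isAlgebraic_adjoin fun x hx => (not_not.1 (hal x hx)).isIntegral
  have : Algebra.IsAlgebraic k F := IntermediateField.topEquiv.isAlgebraic
  have hind := (algebraicIndependent_algebraMap_X (k := k) (σ := G) (T := T)).extendScalars F
  exact hQ0 ((injective_iff_map_eq_zero _).1 hind Q hQ)

theorem card_le_of_compression [FaithfulSMul (MvPolynomial G k) T]
    (htr : Algebra.trdeg k Y ≤ 1) {n : ℕ} (hn : Module.rank (MvPolynomial G k) T ≤ n)
    {act : G →* (Y ≃ₐ[k] Y)} (hact : Function.Injective act) (actT : G → (T ≃ₐ[k] T))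
    (hequiv : ∀ g y, actT g (algebraMap Y T y) = algebraMap Y T (act g y))
    (hX : ∀ g h, actT g (algebraMap (MvPolynomial G k) T (X h)) =
      algebraMap (MvPolynomial G k) T (X (g * h)))
    (hcurves : ∀ (F : Type) [Field F] [Algebra k F], IsCurveField k F →
      genus k F ≤ (n - 1) ^ 2 → ∀ ρ : G →* (F ≃ₐ[k] F), ρ = 1) :
    Nat.card G ≤ n := by
  have hprin := exists_ker_eq_span htr ((extendEval k G Y T).restrictScalars k) (by
    simpa [extendEval] using algebraicIndependent_algebraMap_X (k := k) (σ := G) (T := T))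
  by_cases hbot : RingHom.ker (extendEval k G Y T) = ⊥
  · refine card_le_of_rank_le (rank_le_of_ker_extendEval (T := T) (Q := (0 : MvPolynomial G k)) ?_
      hn) hact
    rw [hbot, map_zero, Ideal.span_singleton_zero]
  obtain ⟨Q, α₀, hα₀, hQ⟩ := exists_normalized_generator hbot hprin
  obtain ⟨F, hFdef⟩ : ∃ F, F = IntermediateField.adjoin k (Q.coeffs : Set Y) := ⟨_, rfl⟩
  have hF : ∀ g, ∀ y ∈ F, act g y ∈ F := by
    intro g
    suffices h : F ≤ F.comap (act g : Y →ₐ[k] Y) from fun y hy => h hy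
    rw [hFdef]
    refine IntermediateField.adjoin_le_iff.2 fun y hy => ?_
    obtain ⟨α, -, rfl⟩ := mem_coeffs_iff.1 (Finset.mem_coe.1 hy)
    exact apply_coeff_mem_adjoin_coeffs hQ hα₀ (act g) (actT g) (Equiv.mulLeft g) (hequiv g)
      (hX g) α
  obtain ⟨Q, rfl⟩ : Q ∈ Set.range (MvPolynomial.map (σ := G) (algebraMap F Y)) := by
    rw [mem_range_map_iff_coeffs_subset]
    exact fun c hc => ⟨⟨c, hFdef ▸ IntermediateField.subset_adjoin _ _ hc⟩, rfl⟩
  have hα₁ : coeff α₀ Q = 1 := (algebraMap F Y).injective (by rw [← coeff_map, hα₀, map_one])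
  have hone : 1 ∈ Q.coeffs := hα₁ ▸ coeff_mem_coeffs α₀ (hα₁ ▸ one_ne_zero)
  have hgen : IntermediateField.adjoin k (Q.coeffs : Set F) = ⊤ := by
    apply IntermediateField.lift_injective F
    rw [IntermediateField.lift_top]
    refine le_antisymm (IntermediateField.lift_le _) ?_
    rw [ IntermediateField.lift_adjoin]
    nth_rw 1 [hFdef]
    exact IntermediateField.adjoin.mono _ _ _ (coe_coeffs_map _ _)
  obtain ⟨x, hxQ, hx⟩ := exists_transcendental_coeff (T := T)
    (ne_zero_iff.2 ⟨α₀, hα₁ ▸ one_ne_zero⟩) (extendEval_eq_zero hQ) hgen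
  have hfg : IsFunctionField k F := ⟨Q.coeffs, hgen⟩
  have htrF : Algebra.trdeg k F ≤ 1 :=
    (trdeg_le_of_injective F.val F.val.injective).trans htr
  have hcurve : IsCurveField k F :=
    ⟨hfg, ⟨{x}, by simp, by
      rw [Finset.coe_singleton]; exact isAlgebraic_adjoin_of_trdeg_le_one htrF hx⟩, x, hx⟩
  exact card_le_of_restrictAction_eq_one (rank_le_of_ker_extendEval hQ hn) hact hF
    (hcurves F hcurve (genus_le_of_relation hfg htrF (fun _ => dvd_of_extendEval_eq_zero hQ)
      hone hxQ hx hgen hn) _)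

end Compression

theorem isFunctionField_fractionRing (k σ : Type) [Field k] [Finite σ] :
    IsFunctionField k (FractionRing (MvPolynomial σ k)) := by
  classical
  have := Fintype.ofFinite σ
  refine ⟨Finset.univ.image fun i => algebraMap (MvPolynomial σ k) _ (MvPolynomial.X i), ?_⟩
  rw [eq_top_iff]
  intro x _
  have hmem : ∀ p : MvPolynomial σ k, algebraMap _ (FractionRing (MvPolynomial σ k)) p ∈
      IntermediateField.adjoin k ((Finset.univ.image fun i : σ =>
        algebraMap (MvPolynomial σ k) (FractionRing (MvPolynomial σ k)) (MvPolynomial.X i) :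
          Finset _) : Set (FractionRing (MvPolynomial σ k))) := by
    intro p
    induction p using MvPolynomial.induction_on with
    | C a =>
      rw [← MvPolynomial.algebraMap_eq, ← IsScalarTower.algebraMap_apply]
      exact IntermediateField.algebraMap_mem _ a
    | add p q hp hq => rw [map_add]; exact add_mem hp hq
    | mul_X p i hp =>
      rw [map_mul]
      exact mul_mem hp (IntermediateField.subset_adjoin _ _ (by simp))
  obtain ⟨p, q, -, rfl⟩ := IsFractionRing.div_surjective (MvPolynomial σ k) x
  exact div_mem (hmem p) (hmem q)

section PermutationVariety

variable (k G : Type) [Field k] [Group G]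

/-- The left regular permutation action of `G` on the polynomial ring `k[G]`. -/
noncomputable def regularAction : G →* (MvPolynomial G k ≃ₐ[k] MvPolynomial G k) where
  toFun g := MvPolynomial.renameEquiv k (Equiv.mulLeft g)
  map_one' := by
    ext p
    simp [MvPolynomial.rename_id]
  map_mul' g h := AlgEquiv.coe_toAlgHom_injective (MvPolynomial.algHom_ext fun i => by
    simp [mul_assoc])

theorem regularAction_X (g h : G) :
    regularAction k G g (MvPolynomial.X h) = MvPolynomial.X (g * h) := by
  simp [regularAction]

theorem regularAction_injective : Function.Injective (regularAction k G) := by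
  intro g h hgh
  have := AlgEquiv.congr_fun hgh (MvPolynomial.X 1)
  rw [regularAction_X, regularAction_X, mul_one, mul_one] at this
  exact MvPolynomial.X_injective this

theorem fieldEquivOfAlgEquivHom_regularAction_X (g h : G) :
    IsFractionRing.fieldEquivOfAlgEquivHom k (FractionRing (MvPolynomial G k))
        (regularAction k G g) (algebraMap (MvPolynomial G k) _ (MvPolynomial.X h)) =
      algebraMap (MvPolynomial G k) _ (MvPolynomial.X (g * h)) := by
  rw [IsFractionRing.fieldEquivOfAlgEquivHom_apply, IsFractionRing.fieldEquivOfAlgEquiv_algebraMap,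
    regularAction_X]

/-- The `G`-variety given by affine space with the regular permutation action. -/
noncomputable def regularVariety [Finite G] : GVariety k G where
  K := FractionRing (MvPolynomial G k)
  fg := isFunctionField_fractionRing k G
  action := (IsFractionRing.fieldEquivOfAlgEquivHom k (FractionRing (MvPolynomial G k))).comp
    (regularAction k G)
  faithful := (IsFractionRing.fieldEquivOfAlgEquivHom_injective k (MvPolynomial G k) k _).comp
    (regularAction_injective k G)

end PermutationVariety

theorem rank_le_of_finrank_fieldRange_le {k R K T : Type} [Field k] [CommRing R] [IsDomain R]
    [Field K] [Field T] [Algebra k K] [Algebra k T] [Algebra R K] [IsFractionRing R K]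
    [Algebra R T] (ι : K →ₐ[k] T) (hι : ∀ r, algebraMap R T r = ι (algebraMap R K r))
    [FiniteDimensional ι.fieldRange T] {n : ℕ} (hn : Module.finrank ι.fieldRange T ≤ n) :
    Module.rank R T ≤ n := by
  let := ι.toRingHom.toAlgebra
  have : IsScalarTower R K T := .of_algebraMap_eq hι
  have hrank : Module.rank K T ≤ n := by
    rw [rank_eq_of_equiv_equiv (R' := ι.fieldRange) (M₁ := T) (fun x => ⟨ι x, x, rfl⟩)
      (AddEquiv.refl T) ⟨fun x y h => ι.injective (congrArg Subtype.val h),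
        fun ⟨y, x, hx⟩ => ⟨x, Subtype.ext hx⟩⟩ fun x t => rfl, ← Module.finrank_eq_rank]
    exact_mod_cast hn
  refine rank_le fun s hs => ?_
  have h := ((LinearIndependent.iff_fractionRing R K).1 hs).cardinal_le_rank.trans hrank
  simpa using h

/-- **Main Theorem.** Let `k` be a perfect field, `n ≥ 2`, and `G` a finite group
such that: (1) `G` has no proper subgroup of index at most `n`; (2) `G` contains a
subgroup `M` with `|M| > n` acting faithfully on `P¹` over `k` (i.e. faithfully on
`k(t)` by `k`-automorphisms); and (3) `G` does not act nontrivially on a smooth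
curve of genus `g ≤ (n-1)²`.  Then `ed_k(G; ≤ n) > 1`. -/
theorem main_theorem (k : Type) [Field k] [PerfectField k] (n : ℕ) (hn : 2 ≤ n)
    (G : Type) [Group G] [Finite G]
    (hindex : ∀ H : Subgroup G, H ≠ ⊤ → n < H.index)
    (hM : ∃ M : Subgroup G, n < Nat.card M ∧
      ∃ a : M →* (RatFunc k ≃ₐ[k] RatFunc k), Function.Injective a)
    (hcurves : ∀ (F : Type) [Field F] [Algebra k F], IsCurveField k F →
      genus k F ≤ (n - 1) ^ 2 → ∀ ρ : G →* (F ≃ₐ[k] F), ρ = 1) :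
    ¬ EDLE k G n 1 := by
  intro h
  obtain ⟨M, hMn, -⟩ := hM
  obtain ⟨T, Y, ⟨ι, hfin, hdeg, hι⟩, ⟨φ, hφ⟩, hY⟩ := h (regularVariety k G)
  let R := MvPolynomial G k
  let ι' : FractionRing R →ₐ[k] T.K := ι
  let := φ.toRingHom.toAlgebra
  let := (ι'.toRingHom.comp (algebraMap R (FractionRing R))).toAlgebra
  have : IsScalarTower k Y.K T.K := .of_algebraMap_eq fun x => (φ.commutes x).symm
  have : IsScalarTower k R T.K := .of_algebraMap_eq fun x => by
    change _ = ι' (algebraMap R _ (algebraMap k R x))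
    rw [← IsScalarTower.algebraMap_apply, ι'.commutes]
  have : FaithfulSMul R T.K := (faithfulSMul_iff_algebraMap_injective R T.K).2
    (ι'.injective.comp (IsFractionRing.injective R (FractionRing R)))
  have hX : ∀ g h : G, T.action g (algebraMap R T.K (MvPolynomial.X h)) =
      algebraMap R T.K (MvPolynomial.X (g * h)) := fun g h =>
    (hι g (algebraMap R (FractionRing R) (MvPolynomial.X h))).trans
      (congrArg ι' (fieldEquivOfAlgEquivHom_regularAction_X k G g h))
  have : FiniteDimensional ι'.fieldRange T.K := hfin
  have hcard := card_le_of_compression (by exact_mod_cast hY.trdeg_le)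
    (rank_le_of_finrank_fieldRange_le (R := R) ι' (fun _ => rfl) hdeg) Y.faithful T.action
    (fun g y => hφ g y) hX hcurves
  exact absurd (hMn.trans_le ((Subgroup.card_le_card_group M).trans hcard)) (lt_irrefl n)
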